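/- Let G = ⟨h₁, …, h_m⟩ be a rational semigroup; when m = 1, assume h₁ is neither the identity nor an elliptic Möbius transformation. Suppose that G satisfies the open set condition with an open set U with respect to the generator system {h₁, …, h_m}, and that J(G) ≠ Ū. Then there exists an open set V contained in U ∩ F(G) such that for almost every x ∈ V with respect to the two-dimensional Lebesgue measure, S(2, x) < ∞. In particular, s₀(G) ≤ 2. -/

import Mathlib

open Set Metric Topology Filter MeasureTheory

noncomputable section

/-- The Riemann sphere `ℂ̂`, as a type synonym of the one-point compactification
`Option ℂ = OnePoint ℂ` of `ℂ`, equipped below with the spherical metric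
(induced by a stereographic-type embedding into `ℂ × ℝ`). -/
def CSphere : Type := Option ℂ

namespace CSphere

/-- The point at infinity of the Riemann sphere. -/
def infty : CSphere := (none : Option ℂ)

/-- The inclusion of `ℂ` into the Riemann sphere. -/
def ofC (z : ℂ) : CSphere := (some z : Option ℂ)

/-- A stereographic-type embedding of the Riemann sphere into `ℂ × ℝ`,
used to induce the spherical metric. -/
def embed (z : CSphere) : ℂ × ℝ :=
  Option.rec ((0 : ℂ), (1 : ℝ))
    (fun w => ((2 / (1 + ‖w‖ ^ 2)) • w, (‖w‖ ^ 2 - 1) / (‖w‖ ^ 2 + 1))) z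

@[simp] lemma embed_infty : embed infty = ((0 : ℂ), (1 : ℝ)) := rfl

@[simp] lemma embed_ofC (w : ℂ) :
    embed (ofC w) = (((2 / (1 + ‖w‖ ^ 2)) • w : ℂ), (‖w‖ ^ 2 - 1) / (‖w‖ ^ 2 + 1)) := rfl

lemma cases' (z : CSphere) : z = infty ∨ ∃ w : ℂ, z = ofC w :=
  Option.rec (Or.inl rfl) (fun w => Or.inr ⟨w, rfl⟩) z

lemma embed_inj : Function.Injective embed := by
  intro a b h
  rcases cases' a with rfl | ⟨v, rfl⟩ <;> rcases cases' b with rfl | ⟨w, rfl⟩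
  · rfl
  · exfalso
    have h2 := congrArg Prod.snd h
    simp only [embed_infty, embed_ofC] at h2
    have hw : (0:ℝ) < ‖w‖ ^ 2 + 1 := by positivity
    rw [eq_div_iff (by nlinarith : (‖w‖ ^ 2 + 1 : ℝ) ≠ 0)] at h2
    nlinarith
  · exfalso
    have h2 := congrArg Prod.snd h
    simp only [embed_infty, embed_ofC] at h2
    have hv : (0:ℝ) < ‖v‖ ^ 2 + 1 := by positivity
    rw [div_eq_iff (by nlinarith : (‖v‖ ^ 2 + 1 : ℝ) ≠ 0)] at h2
    nlinarith
  · have h2 := congrArg Prod.snd h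
    simp only [embed_ofC] at h2
    have hv : (0:ℝ) < ‖v‖ ^ 2 + 1 := by positivity
    have hw : (0:ℝ) < ‖w‖ ^ 2 + 1 := by positivity
    have hnorm : ‖v‖ ^ 2 = ‖w‖ ^ 2 := by
      rw [div_eq_div_iff (by nlinarith : (‖v‖ ^ 2 + 1 : ℝ) ≠ 0)
        (by nlinarith : (‖w‖ ^ 2 + 1 : ℝ) ≠ 0)] at h2
      nlinarith
    have h1 := congrArg Prod.fst h
    simp only [embed_ofC, hnorm] at h1
    have hc : (2 / (1 + ‖w‖ ^ 2) : ℝ) ≠ 0 := by positivity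
    exact congrArg ofC (smul_right_injective ℂ hc h1)

/-- The spherical metric on the Riemann sphere. -/
instance : MetricSpace CSphere := MetricSpace.induced embed embed_inj inferInstance

instance : MeasurableSpace CSphere := borel CSphere

instance : BorelSpace CSphere := ⟨rfl⟩

/-- The self-map of the Riemann sphere induced by a pair of polynomials `p, q`,
i.e. the rational map `z ↦ p(z)/q(z)`. -/
def ratLift (p q : Polynomial ℂ) (z : CSphere) : CSphere :=
  Option.rec
    (if q.natDegree < p.natDegree then infty
     else if p.natDegree < q.natDegree then ofC 0
     else ofC (p.leadingCoeff / q.leadingCoeff))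
    (fun w => if q.eval w = 0 then infty else ofC (p.eval w / q.eval w)) z

/-- `φ` is the rational map on the Riemann sphere determined by the coprime
pair of polynomials `(p, q)` with `q ≠ 0`. -/
def IsRatPair (p q : Polynomial ℂ) (φ : CSphere → CSphere) : Prop :=
  q ≠ 0 ∧ IsCoprime p q ∧ φ = ratLift p q

/-- `φ` is a rational map of degree `n` on the Riemann sphere. -/
def ratDegEq (φ : CSphere → CSphere) (n : ℕ) : Prop :=
  ∃ p q : Polynomial ℂ, IsRatPair p q φ ∧ max p.natDegree q.natDegree = n

/-- `φ` is a rational map on the Riemann sphere (constants allowed). -/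
def IsRatMap (φ : CSphere → CSphere) : Prop := ∃ n, ratDegEq φ n

/-- `φ` is a Möbius transformation of the Riemann sphere. -/
def IsMobius (φ : CSphere → CSphere) : Prop := ratDegEq φ 1

/-- `φ` is a non-constant rational map on the Riemann sphere. -/
def IsNonconstRatMap (φ : CSphere → CSphere) : Prop := ∃ n, 1 ≤ n ∧ ratDegEq φ n

/-- `φ` is a rational map of degree at least two. -/
def IsRatMapDegGeTwo (φ : CSphere → CSphere) : Prop := ∃ n, 2 ≤ n ∧ ratDegEq φ n

end CSphere

/-- For a proper holomorphic map `g : V → B`, "`deg (g : V → B) ≤ N`":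
every point of `B` has at most `N` preimages in `V`.  (For proper holomorphic
maps this is equivalent to the degree, counted with multiplicity, being `≤ N`,
since a generic point has `deg` distinct preimages.) -/
def degLe {α β : Type*} (gmap : α → β) (V : Set α) (B : Set β) (N : ℕ) : Prop :=
  ∀ w ∈ B, (V ∩ gmap ⁻¹' {w}).ncard ≤ N

/-- `K` is `C`-uniformly perfect: `K` has at least two points, and every round
annulus `{z | r < dist a z < R}` disjoint from `K` which separates `K`
has modulus `log (R/r) / (2π) < C`.  (By Teichmüller's theorem this round-annulus
formulation is equivalent to the formulation with arbitrary separating ring domains.) -/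
def UnifPerfect {α : Type*} [MetricSpace α] (K : Set α) (C : ℝ) : Prop :=
  K.Nontrivial ∧ ∀ (a : α) (r R : ℝ), 0 < r → r < R →
    (∀ z ∈ K, dist a z ≤ r ∨ R ≤ dist a z) →
    (K ∩ {z | dist a z ≤ r}).Nonempty →
    (K ∩ {z | R ≤ dist a z}).Nonempty →
    Real.log (R / r) < 2 * Real.pi * C

/-- `J` is `k`-porous: every ball `B(x,r)` centred on `J` contains a ball of
radius `k r` disjoint from `J`. -/
def kPorous {α : Type*} [MetricSpace α] (J : Set α) (k : ℝ) : Prop :=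
  ∀ x ∈ J, ∀ r > (0:ℝ), ∃ y, Metric.ball y (k * r) ⊆ Metric.ball x r \ J

/-- `J` is `k`-porous inside the subspace `A`: for every `x ∈ J` and `r > 0`
there is a relative ball in `A` of radius `k r` inside `B(x,r) ∩ A` missing `J`. -/
def kPorousIn {α : Type*} [MetricSpace α] (A J : Set α) (k : ℝ) : Prop :=
  ∀ x ∈ J, ∀ r > (0:ℝ), ∃ y ∈ A, A ∩ Metric.ball y (k * r) ⊆ (A ∩ Metric.ball x r) \ J

/-- Minimal number of balls of radius `r` needed to cover `s`. -/
def coverNum {α : Type*} [MetricSpace α] (s : Set α) (r : ℝ) : ℕ∞ :=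
  sInf {n : ℕ∞ | ∃ t : Finset α, (t.card : ℕ∞) = n ∧ s ⊆ ⋃ y ∈ t, Metric.ball y r}

/-- The upper box (Minkowski) dimension of a (bounded) set. -/
def upperBoxDim {α : Type*} [MetricSpace α] (s : Set α) : ℝ :=
  Filter.limsup (fun r : ℝ => Real.log ((coverNum s r).toNat : ℝ) / Real.log (1 / r))
    (𝓝[>] (0:ℝ))

/-- The norm of the derivative of `φ` at `z` with respect to the metrics of the
source and target (for a holomorphic map between spheres with their spherical
metrics, this is the usual spherical derivative `‖φ′(z)‖`). -/
def sphDeriv {α β : Type*} [MetricSpace α] [MetricSpace β] (φ : α → β) (z : α) : ℝ :=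
  Filter.limsup (fun w => dist (φ w) (φ z) / dist w z) (𝓝[≠] z)

/-- The derivative of `φ` along `S` vanishes at `z` (i.e. `z` is a critical point
with `φ′(z) = 0`, expressed metrically). -/
def critPtOn {α β : Type*} [MetricSpace α] [MetricSpace β] (φ : α → β) (S : Set α)
    (z : α) : Prop :=
  Filter.Tendsto (fun w => dist (φ w) (φ z) / dist w z) (𝓝[S \ {z}] z) (𝓝 0)

end
noncomputable section

open Set Metric Topology Filter MeasureTheory
open scoped ENNReal NNReal

/-- `G` is a rational semigroup: a set of non-constant rational self-maps of the
Riemann sphere closed under composition. -/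
def RatSemigroup (G : Set (CSphere → CSphere)) : Prop :=
  (∀ a ∈ G, ∀ b ∈ G, a ∘ b ∈ G) ∧ ∀ a ∈ G, CSphere.IsNonconstRatMap a

/-- The semigroup (under composition) generated by a set `S` of self-maps. -/
def genSet (S : Set (CSphere → CSphere)) : Set (CSphere → CSphere) :=
  {gm | ∃ l : List (CSphere → CSphere), l ≠ [] ∧ (∀ a ∈ l, a ∈ S) ∧
    gm = l.foldr (· ∘ ·) id}

/-- The rational semigroup `⟨h₁, …, h_m⟩` generated by finitely many maps. -/
def genFin {m : ℕ} (h : Fin m → CSphere → CSphere) : Set (CSphere → CSphere) :=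
  genSet (Set.range h)

/-- `H` is a subsemigroup of `G`. -/
def IsSubsemigroupOf (H G : Set (CSphere → CSphere)) : Prop :=
  H.Nonempty ∧ H ⊆ G ∧ ∀ a ∈ H, ∀ b ∈ H, a ∘ b ∈ H

/-- The Fatou set `F(G)` of a rational semigroup: the set of points having a
neighbourhood on which the family `G` is (uniformly) equicontinuous —
equivalently (by the Arzelà–Ascoli theorem, since `ℂ̂` is compact), normal. -/
def rsFatou (G : Set (CSphere → CSphere)) : Set CSphere :=
  {z | ∃ r > (0:ℝ), ∀ ε > (0:ℝ), ∃ δ > (0:ℝ), ∀ gm ∈ G,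
    ∀ w₁ ∈ ball z r, ∀ w₂ ∈ ball z r, dist w₁ w₂ < δ → dist (gm w₁) (gm w₂) < ε}

/-- The Julia set `J(G) = ℂ̂ \ F(G)`. -/
def rsJulia (G : Set (CSphere → CSphere)) : Set CSphere := (rsFatou G)ᶜ

/-- The set of exceptional points `E(G)`: points whose backward orbit contains
at most two points. -/
def rsE (G : Set (CSphere → CSphere)) : Set CSphere :=
  {z | ∃ a b : CSphere, {w | ∃ gm ∈ G, gm w = z} ⊆ {a, b}}

/-- `SH_N(G)`: the set of semi-hyperbolic points of degree `N` for the rational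
semigroup `G`. -/
def rsSHN (G : Set (CSphere → CSphere)) (N : ℕ) : Set CSphere :=
  {z | ∃ δ > (0:ℝ), ∀ gm ∈ G, ∀ y ∈ gm ⁻¹' ball z δ,
    degLe gm (connectedComponentIn (gm ⁻¹' ball z δ) y) (ball z δ) N}

/-- `UH(G) = ℂ̂ \ ⋃_N SH_N(G)`. -/
def rsUH (G : Set (CSphere → CSphere)) : Set CSphere := (⋃ N : ℕ, rsSHN G N)ᶜ

/-- `G = ⟨h₁, …, h_m⟩` satisfies the (backward) open set condition with the
open set `U` with respect to the generator system `h`. -/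
def OpenSetCond {m : ℕ} (h : Fin m → CSphere → CSphere) (U : Set CSphere) : Prop :=
  U.Nonempty ∧ IsOpen U ∧ (∀ j, h j ⁻¹' U ⊆ U) ∧
    Pairwise fun i j => Disjoint (h i ⁻¹' U) (h j ⁻¹' U)

/-- `μ` is a `δ`-subconformal measure for `G`. -/
def Subconformal (G : Set (CSphere → CSphere)) (δ : ℝ)
    (μ : MeasureTheory.Measure CSphere) : Prop :=
  ∀ gm ∈ G, ∀ A : Set CSphere, MeasurableSet A →
    μ (gm '' A) ≤ ∫⁻ z in A, ENNReal.ofReal (sphDeriv gm z ^ δ) ∂μ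

/-- `s(G)`: the infimum of exponents `δ ≥ 0` admitting a `δ`-subconformal
probability measure for `G`. -/
def sExp (G : Set (CSphere → CSphere)) : ℝ :=
  sInf {δ : ℝ | 0 ≤ δ ∧ ∃ μ : MeasureTheory.Measure CSphere,
    MeasureTheory.IsProbabilityMeasure μ ∧ Subconformal G δ μ}

/-- The Poincaré series `S(s, x) = ∑_{g ∈ G} ∑_{g(y) = x} ‖g′(y)‖^{-s}`. -/
def Ssum (G : Set (CSphere → CSphere)) (s : ℝ) (x : CSphere) : ℝ≥0∞ :=
  ∑' gm : G, ∑' y : ((gm : CSphere → CSphere) ⁻¹' {x}),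
    ENNReal.ofReal (sphDeriv (gm : CSphere → CSphere) (y : CSphere) ^ (-s))

/-- `s₀(G) = inf_x S(x) = inf {s | ∃ x, S(s, x) < ∞}`. -/
def s0Exp (G : Set (CSphere → CSphere)) : ℝ :=
  sInf {s : ℝ | ∃ x : CSphere, Ssum G s x < ⊤}

/-- The conical Julia set `J_con(G)` of a rational semigroup. -/
def rsJcon (G : Set (CSphere → CSphere)) : Set CSphere :=
  {z | z ∈ rsJulia G ∧ ∃ (N : ℕ) (r : ℝ), 0 < r ∧ ∀ ε > (0:ℝ), ∃ gm ∈ G,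
    gm z ∈ rsJulia G ∧
    Metric.diam (connectedComponentIn (gm ⁻¹' ball (gm z) r) z) ≤ ε ∧
    SimplyConnectedSpace ↥(connectedComponentIn (gm ⁻¹' ball (gm z) r) z) ∧
    degLe gm (connectedComponentIn (gm ⁻¹' ball (gm z) r) z) (ball (gm z) r) N}

/-- The rational map `z ↦ 1/z` on the Riemann sphere. -/
def sphInv : CSphere → CSphere := CSphere.ratLift 1 Polynomial.X

/-- The (complex) derivative of `h` at a fixed point `z` equals `d`, computed in
the affine chart at `z` (the chart `w ↦ 1/w` if `z = ∞`). -/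
def derivFixEq (h : CSphere → CSphere) (z : CSphere) (d : ℂ) : Prop :=
  (∃ zc : ℂ, z = CSphere.ofC zc ∧ ∃ Floc : ℂ → ℂ,
      (∀ᶠ w in 𝓝 zc, CSphere.ofC (Floc w) = h (CSphere.ofC w)) ∧
      HasDerivAt Floc d zc) ∨
  (z = CSphere.infty ∧ ∃ Floc : ℂ → ℂ,
      (∀ᶠ w in 𝓝 (0:ℂ), CSphere.ofC (Floc w) = sphInv (h (sphInv (CSphere.ofC w)))) ∧
      HasDerivAt Floc d 0)

/-- `z` is a parabolic fixed point of `h`: `h(z) = z` and `h′(z)` is a root of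
unity. -/
def IsParabolicFixPt (h : CSphere → CSphere) (z : CSphere) : Prop :=
  h z = z ∧ ∃ d : ℂ, derivFixEq h z d ∧ ∃ n : ℕ, 0 < n ∧ d ^ n = 1

/-- `φ` is an elliptic Möbius transformation: a Möbius map with a fixed point
whose multiplier has modulus one and is different from `1`. -/
def IsEllipticMobius (φ : CSphere → CSphere) : Prop :=
  CSphere.IsMobius φ ∧ ∃ (z : CSphere) (d : ℂ), φ z = z ∧ derivFixEq φ z d ∧
    ‖d‖ = 1 ∧ d ≠ 1

end

noncomputable section
open Set Metric Topology Filter MeasureTheory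
open scoped ENNReal NNReal ComplexConjugate

namespace SP

open CSphere

def mk (v : ℂ × ℂ) : CSphere := if v.2 = 0 then infty else ofC (v.1 / v.2)

def rep (z : CSphere) : ℂ × ℂ := Option.rec ((1:ℂ), (0:ℂ)) (fun w => (w, (1:ℂ))) z

@[simp] lemma rep_infty : rep infty = ((1:ℂ), (0:ℂ)) := rfl
@[simp] lemma rep_ofC (w : ℂ) : rep (ofC w) = (w, (1:ℂ)) := rfl

lemma ofC_inj {a b : ℂ} (h : ofC a = ofC b) : a = b := Option.some.inj h
lemma ofC_ne_infty (a : ℂ) : ofC a ≠ infty := fun h => Option.some_ne_none a h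

lemma mk_one (w : ℂ) : mk (w, 1) = ofC w := by simp [mk]
lemma mk_zero (w : ℂ) : mk (w, 0) = infty := by simp [mk]
lemma mk_ne {a b : ℂ} (hb : b ≠ 0) : mk (a, b) = ofC (a / b) := by simp [mk, hb]

lemma mk_rep (z : CSphere) : mk (rep z) = z := by
  rcases cases' z with rfl | ⟨w, rfl⟩
  · simp [mk]
  · simp [mk]

lemma rep_ne (z : CSphere) : rep z ≠ 0 := by
  rcases cases' z with rfl | ⟨w, rfl⟩ <;> simp [Prod.ext_iff]

lemma mk_smul (c : ℂ) (hc : c ≠ 0) (a b : ℂ) : mk (c * a, c * b) = mk (a, b) := by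
  by_cases hb : b = 0
  · simp [mk, hb]
  · simp [mk, hb, hc, mul_div_mul_left]

/-- if v ≠ 0 then v is a multiple of rep (mk v) -/
lemma eq_smul_rep (v : ℂ × ℂ) (hv : v ≠ 0) :
    ∃ c : ℂ, c ≠ 0 ∧ v = (c * (rep (mk v)).1, c * (rep (mk v)).2) := by
  obtain ⟨a, b⟩ := v
  by_cases hb : b = 0
  · subst hb
    refine ⟨a, ?_, ?_⟩
    · rintro rfl; exact hv rfl
    · simp [mk_zero]
  · refine ⟨b, hb, ?_⟩
    rw [mk_ne hb]; simp [mul_div_cancel₀, hb]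

lemma nsq_pos (v : ℂ × ℂ) (hv : v ≠ 0) : 0 < ‖v.1‖ ^ 2 + ‖v.2‖ ^ 2 := by
  by_cases h1 : v.1 = 0
  · have h2 : v.2 ≠ 0 := fun h2 => hv (Prod.ext h1 h2)
    have := norm_pos_iff.2 h2
    positivity
  · have := norm_pos_iff.2 h1
    positivity

lemma embed_mk (v : ℂ × ℂ) (hv : v ≠ 0) : embed (mk v) =
    ((2 / (‖v.1‖ ^ 2 + ‖v.2‖ ^ 2)) • (v.1 * conj v.2),
      (‖v.1‖ ^ 2 - ‖v.2‖ ^ 2) / (‖v.1‖ ^ 2 + ‖v.2‖ ^ 2)) := by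
  obtain ⟨a, b⟩ := v
  have hp := nsq_pos _ hv
  by_cases hb : b = 0
  · subst hb
    have : ‖a‖ ^ 2 ≠ 0 := by simpa using hp.ne'
    simp [mk_zero, div_self this]
  · rw [mk_ne hb, embed_ofC]
    have hnb : ‖b‖ ≠ 0 := norm_ne_zero_iff.2 hb
    simp only at hp ⊢
    have e : conj b = (‖b‖ ^ 2 : ℂ) / b := by
      rw [eq_div_iff hb, mul_comm, Complex.mul_conj, Complex.normSq_eq_norm_sq]; push_cast; rfl
    have e1 : ((‖a‖ ^ 2 + ‖b‖ ^ 2 : ℝ) : ℂ) ≠ 0 := by exact_mod_cast hp.ne'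
    have e2 : ((‖b‖ : ℝ) : ℂ) ≠ 0 := by exact_mod_cast hnb
    have hq : (1 + ‖a / b‖ ^ 2) = (‖a‖ ^ 2 + ‖b‖ ^ 2) / ‖b‖ ^ 2 := by
      rw [norm_div]; field_simp; ring
    refine Prod.ext ?_ ?_
    · simp only [hq]
      rw [e, Complex.real_smul, Complex.real_smul]
      push_cast at e1 ⊢
      field_simp
    · simp only
      rw [add_comm (‖a / b‖ ^ 2) 1, hq, norm_div]; field_simp

lemma isInducing_embed : IsInducing embed := ⟨rfl⟩

lemma continuousOn_mk : ContinuousOn mk {0}ᶜ := by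
  rw [isInducing_embed.continuousOn_iff]
  have : ContinuousOn (fun v : ℂ × ℂ => (((2 / (‖v.1‖ ^ 2 + ‖v.2‖ ^ 2)) • (v.1 * conj v.2) : ℂ),
      (‖v.1‖ ^ 2 - ‖v.2‖ ^ 2) / (‖v.1‖ ^ 2 + ‖v.2‖ ^ 2))) {0}ᶜ := by
    have hc : Continuous (fun v : ℂ × ℂ => (v.1 * conj v.2)) := by
      exact continuous_fst.mul (Complex.continuous_conj.comp continuous_snd)
    have h1 : ContinuousOn (fun v : ℂ × ℂ => (2 : ℝ) / (‖v.1‖ ^ 2 + ‖v.2‖ ^ 2)) {0}ᶜ :=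
      ContinuousOn.div (by fun_prop) (by fun_prop) fun v hv => (nsq_pos v hv).ne'
    have h2 : ContinuousOn
        (fun v : ℂ × ℂ => (‖v.1‖ ^ 2 - ‖v.2‖ ^ 2) / (‖v.1‖ ^ 2 + ‖v.2‖ ^ 2)) {0}ᶜ :=
      ContinuousOn.div (by fun_prop) (by fun_prop) fun v hv => (nsq_pos v hv).ne'
    exact (h1.smul hc.continuousOn).prodMk h2
  exact this.congr fun v hv => embed_mk v hv

lemma ne_zero_left (w : ℂ) : ((w, 1) : ℂ × ℂ) ≠ 0 := by simp [Prod.ext_iff]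
lemma ne_zero_right (w : ℂ) : ((1, w) : ℂ × ℂ) ≠ 0 := by simp [Prod.ext_iff]

lemma continuous_ofC : Continuous ofC := by
  have : ofC = fun w => mk (w, 1) := by ext1 w; rw [mk_one]
  rw [this]
  exact continuousOn_mk.comp_continuous (by fun_prop) (fun w => ne_zero_left w)

def ofI (w : ℂ) : CSphere := mk (1, w)

lemma continuous_ofI : Continuous ofI :=
  continuousOn_mk.comp_continuous (by fun_prop) (fun w => ne_zero_right w)

lemma continuous_mkAffine (c : ℂ) : Continuous (fun w : ℂ => mk (1 + c * w, w)) := by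
  refine continuousOn_mk.comp_continuous (by fun_prop) (fun w => ?_)
  intro h
  have h2 : w = 0 := congrArg Prod.snd h
  have h1 : 1 + c * w = 0 := congrArg Prod.fst h
  simp [h2] at h1

instance : CompactSpace CSphere := by
  constructor
  have : (univ : Set CSphere) = ofC '' closedBall 0 1 ∪ ofI '' closedBall 0 1 := by
    symm
    rw [eq_univ_iff_forall]
    intro z
    rcases cases' z with rfl | ⟨w, rfl⟩
    · right; exact ⟨0, by simp, by simp [ofI, mk_zero]⟩
    · by_cases hw : ‖w‖ ≤ 1
      · left; exact ⟨w, by simpa using hw, rfl⟩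
      · right
        push Not at hw
        have hw0 : w ≠ 0 := by rintro rfl; simp at hw; linarith
        refine ⟨w⁻¹, ?_, ?_⟩
        · simp; exact inv_le_one_of_one_le₀ hw.le
        · rw [ofI, mk_ne (inv_ne_zero hw0)]; simp
  rw [this]
  exact ((isCompact_closedBall _ _).image continuous_ofC).union
    ((isCompact_closedBall _ _).image continuous_ofI)

instance : PreconnectedSpace CSphere := by
  constructor
  have h : IsPreconnected ({0}ᶜ : Set (ℂ × ℂ)) := by
    refine (isConnected_compl_singleton_of_one_lt_rank (E := ℂ × ℂ) ?_ 0).isPreconnected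
    simp [Complex.rank_real_complex]
    try norm_num
  have h2 := h.image mk continuousOn_mk
  convert h2
  symm
  rw [eq_univ_iff_forall]
  exact fun z => ⟨rep z, rep_ne z, mk_rep z⟩

def toC (z : CSphere) : ℂ := (embed z).1 / ((1 - (embed z).2 : ℝ) : ℂ)

lemma toC_ofC (w : ℂ) : toC (ofC w) = w := by
  simp only [toC, embed_ofC]
  have : (1 + ‖w‖ ^ 2 : ℝ) ≠ 0 := by positivity
  have e : (1 - (‖w‖ ^ 2 - 1) / (‖w‖ ^ 2 + 1) : ℝ) = 2 / (1 + ‖w‖ ^ 2) := by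
    have : (‖w‖ ^ 2 + 1 : ℝ) ≠ 0 := by positivity
    field_simp; ring
  rw [e, Complex.real_smul]
  have : ((2 / (1 + ‖w‖ ^ 2) : ℝ) : ℂ) ≠ 0 := by
    have : (2 / (1 + ‖w‖ ^ 2) : ℝ) ≠ 0 := by positivity
    exact_mod_cast this
  field_simp

lemma one_sub_ne (w : ℂ) : (1 - (embed (ofC w)).2 : ℝ) ≠ 0 := by
  simp only [embed_ofC]
  have : (‖w‖ ^ 2 + 1 : ℝ) ≠ 0 := by positivity
  rw [sub_ne_zero, ne_comm, Ne, div_eq_iff this]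
  intro h; linarith

lemma continuousAt_toC (w : ℂ) : ContinuousAt toC (ofC w) := by
  have he : ContinuousAt embed (ofC w) := isInducing_embed.continuous.continuousAt
  unfold toC
  refine ContinuousAt.div he.fst ?_ ?_
  · exact Complex.continuous_ofReal.continuousAt.comp (continuousAt_const.sub he.snd)
  · exact_mod_cast one_sub_ne w

lemma isOpen_finite : IsOpen (range ofC) := by
  have : range ofC = {infty}ᶜ := by
    ext z
    rcases cases' z with rfl | ⟨w, rfl⟩
    · simp [ofC_ne_infty]
    · simp [ofC_ne_infty]
  rw [this]; exact isOpen_compl_singleton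

lemma isOpenEmbedding_ofC : IsOpenEmbedding ofC := by
  refine IsOpenEmbedding.of_continuous_injective_isOpenMap continuous_ofC (fun a b => ofC_inj) ?_
  refine IsOpenMap.of_nhds_le fun w => ?_
  -- ofC is open
  intro s hs
  rw [mem_map] at hs
  have h1 : toC ⁻¹' (ofC ⁻¹' s) ∈ 𝓝 (ofC w) := by
    apply (continuousAt_toC w).preimage_mem_nhds
    rw [toC_ofC]; exact hs
  have h2 : range ofC ∈ 𝓝 (ofC w) := isOpen_finite.mem_nhds ⟨w, rfl⟩
  filter_upwards [h1, h2]
  rintro _ hz ⟨v, rfl⟩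
  simpa [toC_ofC] using hz

lemma dense_ofC : Dense (range ofC) := by
  have : range ofC = {infty}ᶜ := by
    ext z
    rcases cases' z with rfl | ⟨w, rfl⟩
    · simp [ofC_ne_infty]
    · simp [ofC_ne_infty]
  rw [this, dense_compl_singleton_iff_not_open]
  intro ho
  have : IsOpen (ofI ⁻¹' {infty}) := ho.preimage continuous_ofI
  have e : ofI ⁻¹' {infty} = {0} := by
    ext w
    simp only [mem_preimage, mem_singleton_iff, ofI, mk]
    by_cases hw : w = 0 <;> simp [hw, ofC_ne_infty]
  rw [e] at this
  exact not_isOpen_singleton (0:ℂ) this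

lemma exists_ofC_mem {O : Set CSphere} (ho : IsOpen O) (hn : O.Nonempty) : ∃ w, ofC w ∈ O := by
  obtain ⟨_, hx, w, rfl⟩ := dense_ofC.inter_open_nonempty O ho hn
  exact ⟨w, hx⟩

end SP
end

noncomputable section
open Set Metric Topology Filter MeasureTheory
open scoped ENNReal NNReal ComplexConjugate

namespace SP

open CSphere

def sw (z : CSphere) : CSphere := mk ((rep z).2, (rep z).1)

lemma sw_mk (a b : ℂ) (h : ((a, b) : ℂ × ℂ) ≠ 0) : sw (mk (a, b)) = mk (b, a) := by
  obtain ⟨c, hc, e⟩ := eq_smul_rep _ h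
  have e1 : a = c * (rep (mk (a, b))).1 := congrArg Prod.fst e
  have e2 : b = c * (rep (mk (a, b))).2 := congrArg Prod.snd e
  rw [sw, ← mk_smul c hc, ← e1, ← e2]

lemma swap_ne {a b : ℂ} (h : ((a, b) : ℂ × ℂ) ≠ 0) : ((b, a) : ℂ × ℂ) ≠ 0 := by
  intro h'
  simp [Prod.ext_iff] at h h'
  tauto

lemma sw_sw (z : CSphere) : sw (sw z) = z := by
  conv_rhs => rw [← mk_rep z]
  have h : sw z = mk ((rep z).2, (rep z).1) := rfl
  rw [h]
  exact sw_mk _ _ (swap_ne (rep_ne z))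

lemma continuous_sw : Continuous sw := by
  rw [isInducing_embed.continuous_iff]
  have : embed ∘ sw = (fun p : ℂ × ℝ => (conj p.1, - p.2)) ∘ embed := by
    ext1 z
    have h := rep_ne z
    have h2 : (((rep z).2, (rep z).1) : ℂ × ℂ) ≠ 0 := swap_ne h
    simp only [Function.comp]
    conv_rhs => rw [← mk_rep z]
    rw [sw, embed_mk _ h2, embed_mk _ h]
    refine Prod.ext ?_ ?_
    · simp only [Complex.real_smul, map_mul, Complex.conj_conj, Complex.conj_ofReal]
      rw [add_comm]; ring
    · simp only
      rw [add_comm (‖(rep z).2‖ ^ 2), ← neg_div, neg_sub]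
  rw [this]
  have h : Continuous (fun p : ℂ × ℝ => (conj p.1, - p.2)) :=
    (Complex.continuous_conj.comp continuous_fst).prodMk continuous_snd.neg
  exact h.comp isInducing_embed.continuous

def swH : CSphere ≃ₜ CSphere where
  toFun := sw
  invFun := sw
  left_inv := sw_sw
  right_inv := sw_sw
  continuous_toFun := continuous_sw
  continuous_invFun := continuous_sw

lemma sw_ofC (w : ℂ) : sw (ofC w) = ofI w := by
  rw [← mk_one, sw_mk _ _ (ne_zero_left w)]; rfl

lemma isOpenEmbedding_ofI : IsOpenEmbedding ofI := by
  have : ofI = swH ∘ ofC := by ext1 w; exact (sw_ofC w).symm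
  rw [this]; exact swH.isOpenEmbedding.comp isOpenEmbedding_ofC

lemma exists_chart (z : CSphere) : ∃ (κ : ℂ → CSphere) (ι : CSphere → ℂ) (a : ℂ → ℂ × ℂ) (w₀ : ℂ),
    IsOpenEmbedding κ ∧ (∀ w, ι (κ w) = w) ∧ (∀ w, ContinuousAt ι (κ w)) ∧
    Differentiable ℂ a ∧ (∀ w, a w ≠ 0) ∧ (∀ w, mk (a w) = κ w) ∧ κ w₀ = z := by
  rcases cases' z with rfl | ⟨w, rfl⟩
  · refine ⟨ofI, toC ∘ sw, fun w => (1, w), 0, isOpenEmbedding_ofI, ?_, ?_, by fun_prop,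
      ne_zero_right, fun w => rfl, mk_zero 1⟩
    · intro w; simp only [Function.comp]; rw [← sw_ofC, sw_sw, toC_ofC]
    · intro w
      refine ContinuousAt.comp ?_ continuous_sw.continuousAt
      rw [← sw_ofC, sw_sw]; exact continuousAt_toC w
  · exact ⟨ofC, toC, fun w => (w, 1), w, isOpenEmbedding_ofC, toC_ofC, continuousAt_toC,
      by fun_prop, ne_zero_left, mk_one, rfl⟩

def IsLift (g : CSphere → CSphere) (L : ℂ × ℂ → ℂ × ℂ) : Prop :=
  Differentiable ℂ L ∧ (∀ v, v ≠ 0 → L v ≠ 0) ∧ ∀ v, v ≠ 0 → mk (L v) = g (mk v)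

def Hol (g : CSphere → CSphere) : Prop :=
  (∃ L, IsLift g L) ∧ ∀ x, (g ⁻¹' {x}).Countable

lemma Hol.id : Hol id := by
  refine ⟨⟨_root_.id, differentiable_id, fun v h => h, fun v _ => rfl⟩, fun x => ?_⟩
  simp

lemma Hol.comp {f g : CSphere → CSphere} (hf : Hol f) (hg : Hol g) : Hol (f ∘ g) := by
  obtain ⟨⟨L, h1, h2, h3⟩, h4⟩ := hf
  obtain ⟨⟨M, k1, k2, k3⟩, k4⟩ := hg
  refine ⟨⟨L ∘ M, h1.comp k1, fun v hv => h2 _ (k2 v hv), fun v hv => ?_⟩, fun x => ?_⟩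
  · simp only [Function.comp]; rw [h3 _ (k2 v hv), k3 v hv]
  · have : (f ∘ g) ⁻¹' {x} = ⋃ y ∈ f ⁻¹' {x}, g ⁻¹' {y} := by
      ext z; simp
    rw [this]
    exact (h4 x).biUnion fun y _ => k4 y

lemma Hol.continuous {g : CSphere → CSphere} (hg : Hol g) : Continuous g := by
  obtain ⟨⟨L, h1, h2, h3⟩, -⟩ := hg
  rw [continuous_iff_continuousAt]
  intro z
  obtain ⟨κ, ι, a, w, hκ, -, -, ha, hane, hmk, rfl⟩ := exists_chart z
  rw [hκ.continuousAt_iff.symm]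
  have : g ∘ κ = mk ∘ L ∘ a := by
    ext1 u; simp only [Function.comp]; rw [h3 _ (hane u), hmk]
  rw [this]
  exact (continuousOn_mk.comp_continuous (h1.continuous.comp ha.continuous)
    (fun u => h2 _ (hane u))).continuousAt

lemma Hol.isOpenMap {g : CSphere → CSphere} (hg : Hol g) : IsOpenMap g := by
  obtain ⟨⟨L, h1, h2, h3⟩, hc⟩ := hg
  refine IsOpenMap.of_nhds_le fun z => ?_
  obtain ⟨κ, ι, a, w, hκ, -, -, ha, hane, hmk, rfl⟩ := exists_chart z
  -- general fact
  have key : ∀ (τ : ℂ → CSphere) (f : ℂ → ℂ), IsOpenEmbedding τ → AnalyticAt ℂ f w →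
      (∀ᶠ u in 𝓝 w, g (κ u) = τ (f u)) → 𝓝 (g (κ w)) ≤ map g (𝓝 (κ w)) := by
    intro τ f hτ hf he
    rcases hf.eventually_constant_or_nhds_le_map_nhds with h | h
    · exfalso
      have hn : κ ⁻¹' (g ⁻¹' {g (κ w)}) ∈ 𝓝 w := by
        filter_upwards [h, he] with u hu hu2
        simp only [mem_preimage, mem_singleton_iff]
        rw [hu2, hu, he.self_of_nhds]
      have hcc : (κ ⁻¹' (g ⁻¹' {g (κ w)})).Countable := (hc _).preimage_of_injOn hκ.injective.injOn
      have hd := hcc.dense_compl ℂ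
      rw [← interior_eq_empty_iff_dense_compl] at hd
      rw [_root_.mem_nhds_iff] at hn
      obtain ⟨t, ht, hto, hwt⟩ := hn
      have := interior_maximal ht hto hwt
      rw [hd] at this; exact this
    · rw [he.self_of_nhds, ← hτ.map_nhds_eq]
      calc map τ (𝓝 (f w)) ≤ map τ (map f (𝓝 w)) := map_mono h
        _ = map (fun u => τ (f u)) (𝓝 w) := by rw [map_map]; rfl
        _ = map (fun u => g (κ u)) (𝓝 w) := by
            refine Filter.map_congr ?_
            filter_upwards [he] with u hu using hu.symm
        _ = map g (𝓝 (κ w)) := by rw [← hκ.map_nhds_eq, map_map]; rfl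
  have hd : Differentiable ℂ (L ∘ a) := h1.comp ha
  have hd1 : Differentiable ℂ (fun u => (L (a u)).1) := hd.fst
  have hd2 : Differentiable ℂ (fun u => (L (a u)).2) := hd.snd
  have hgk : ∀ u, g (κ u) = mk ((L (a u)).1, (L (a u)).2) := by
    intro u; rw [← hmk, ← h3 _ (hane u)]
  by_cases hQ : (L (a w)).2 = 0
  · have hP : (L (a w)).1 ≠ 0 := fun hP => h2 _ (hane w) (Prod.ext hP hQ)
    have hP' : ∀ᶠ u in 𝓝 w, (L (a u)).1 ≠ 0 := hd1.continuous.continuousAt.eventually_ne hP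
    refine key ofI (fun u => (L (a u)).2 / (L (a u)).1) isOpenEmbedding_ofI
      ((hd2.analyticAt w).div (hd1.analyticAt w) hP) ?_
    filter_upwards [hP'] with u hu
    rw [hgk, ofI, ← mk_smul _ hu 1, mul_one, mul_div_cancel₀ _ hu]
  · have hQ' : ∀ᶠ u in 𝓝 w, (L (a u)).2 ≠ 0 := hd2.continuous.continuousAt.eventually_ne hQ
    refine key ofC (fun u => (L (a u)).1 / (L (a u)).2) isOpenEmbedding_ofC
      ((hd1.analyticAt w).div (hd2.analyticAt w) hQ) ?_
    filter_upwards [hQ'] with u hu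
    rw [hgk, mk_ne hu]

lemma Hol.surjective {g : CSphere → CSphere} (hg : Hol g) : Function.Surjective g := by
  have h1 : IsOpen (range g) := hg.isOpenMap.isOpen_range
  have h2 : IsClosed (range g) := (isCompact_range hg.continuous).isClosed
  have : IsClopen (range g) := ⟨h2, h1⟩
  exact range_eq_univ.1 (this.eq_univ ⟨g infty, infty, rfl⟩)

/-- Easy Montel: omitting a nonempty open set. -/
lemma montel (G : Set (CSphere → CSphere)) (hG : ∀ g ∈ G, Hol g) (D O : Set CSphere)
    (hD : IsOpen D) (hO : IsOpen O) (hOn : O.Nonempty) (h : ∀ g ∈ G, ∀ x ∈ D, g x ∉ O) :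
    D ⊆ rsFatou G := by
  intro z hz
  obtain ⟨c, hc⟩ := exists_ofC_mem hO hOn
  obtain ⟨ρ, hρ, hρO⟩ : ∃ ρ > 0, ball c ρ ⊆ ofC ⁻¹' O :=
    Metric.isOpen_iff.1 (hO.preimage continuous_ofC) c hc
  obtain ⟨κ, ι, a, w₀, hκ, hι, hιc, ha, hane, hmk, rfl⟩ := exists_chart z
  obtain ⟨R', hR', hRD⟩ : ∃ R > 0, ball w₀ R ⊆ κ ⁻¹' D :=
    Metric.isOpen_iff.1 (hD.preimage hκ.continuous) w₀ hz
  set R := R' / 3 with hR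
  have hRpos : 0 < R := by positivity
  set M := 1 / ρ with hM
  have hMpos : 0 < M := by positivity
  set Ψ : ℂ → CSphere := fun u => mk (1 + c * u, u) with hΨ
  have hΨu : UniformContinuousOn Ψ (closedBall 0 M) :=
    (isCompact_closedBall _ _).uniformContinuousOn_of_continuous
      (continuous_mkAffine c).continuousOn
  have hfac : ∀ g ∈ G, ∃ f : ℂ → ℂ, DifferentiableOn ℂ f (ball w₀ R') ∧
      (∀ w ∈ ball w₀ R', ‖f w‖ ≤ M) ∧ ∀ w ∈ ball w₀ R', g (κ w) = Ψ (f w) := by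
    intro g hg
    obtain ⟨⟨L, h1, h2, h3⟩, -⟩ := hG g hg
    have hd : Differentiable ℂ (L ∘ a) := h1.comp ha
    have hd1 : Differentiable ℂ (fun u => (L (a u)).1) := hd.fst
    have hd2 : Differentiable ℂ (fun u => (L (a u)).2) := hd.snd
    have hgk : ∀ u, g (κ u) = mk ((L (a u)).1, (L (a u)).2) := by
      intro u; rw [← hmk, ← h3 _ (hane u)]
    have hne : ∀ w ∈ ball w₀ R', (L (a w)).1 - c * (L (a w)).2 ≠ 0 := by
      intro w hw h0
      have hP : (L (a w)).1 = c * (L (a w)).2 := sub_eq_zero.1 h0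
      have hQ : (L (a w)).2 ≠ 0 := by
        intro hQ; rw [hQ, mul_zero] at hP
        exact h2 _ (hane w) (Prod.ext hP hQ)
      apply h g hg _ (hRD hw)
      rw [hgk, mk_ne hQ, hP, mul_div_cancel_right₀ _ hQ]; exact hc
    have hval : ∀ w ∈ ball w₀ R', g (κ w) = Ψ ((L (a w)).2 / ((L (a w)).1 - c * (L (a w)).2)) := by
      intro w hw
      have := hne w hw
      rw [hgk, hΨ]
      simp only
      rw [← mk_smul _ this (1 + _)]
      congr 2
      · field_simp
        ring
      · rw [mul_div_cancel₀ _ this]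
    refine ⟨fun u => (L (a u)).2 / ((L (a u)).1 - c * (L (a u)).2), ?_, ?_, hval⟩
    · intro w hw
      exact ((hd2 w).div ((hd1 w).sub ((differentiableAt_const c).mul (hd2 w)))
        (hne w hw)).differentiableWithinAt
    · intro w hw
      have hv := hval w hw
      simp only
      set f := (L (a w)).2 / ((L (a w)).1 - c * (L (a w)).2) with hf
      by_contra hlt
      push Not at hlt
      have hfpos : 0 < ‖f‖ := hMpos.trans hlt
      have hf0 : f ≠ 0 := norm_pos_iff.1 hfpos
      apply h g hg _ (hRD hw)
      rw [hv, hΨ]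
      simp only
      rw [mk_ne hf0]
      apply hρO
      rw [mem_ball, dist_eq_norm]
      have : (1 + c * f) / f - c = f⁻¹ := by field_simp; ring
      rw [this, norm_inv, inv_lt_comm₀ hfpos hρ]
      simpa [hM] using hlt
  have hLip : ∀ f : ℂ → ℂ, DifferentiableOn ℂ f (ball w₀ R') →
      (∀ w ∈ ball w₀ R', ‖f w‖ ≤ M) → ∀ w₁ ∈ ball w₀ R, ∀ w₂ ∈ ball w₀ R,
      ‖f w₂ - f w₁‖ ≤ M / R * ‖w₂ - w₁‖ := by
    intro f hf hfM w₁ h₁ w₂ h₂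
    have hsub : ∀ w ∈ ball w₀ R, closedBall w R ⊆ ball w₀ R' := by
      intro w hw u hu
      rw [mem_ball] at *
      rw [mem_closedBall] at hu
      have := dist_triangle u w w₀
      linarith
    refine Convex.norm_image_sub_le_of_norm_deriv_le (f := f) (𝕜 := ℂ) (s := ball w₀ R)
      (fun w hw => ?_) (fun w hw => ?_) (convex_ball _ _) h₁ h₂
    · exact hf.differentiableAt (isOpen_ball.mem_nhds (hsub w hw (mem_closedBall_self hRpos.le)))
    · refine Complex.norm_deriv_le_of_forall_mem_sphere_norm_le hRpos ?_ ?_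
      · refine DifferentiableOn.diffContOnCl (hf.mono ?_)
        exact (closure_ball_subset_closedBall).trans (hsub w hw)
      · intro u hu
        exact hfM _ (hsub w hw (sphere_subset_closedBall hu))
  have hK : IsCompact (κ '' closedBall w₀ R) := (isCompact_closedBall _ _).image hκ.continuous
  have hιu : UniformContinuousOn ι (κ '' closedBall w₀ R) := by
    apply hK.uniformContinuousOn_of_continuous
    rintro _ ⟨w, -, rfl⟩
    exact (hιc w).continuousWithinAt
  have hop : IsOpen (κ '' ball w₀ R) := hκ.isOpenMap _ isOpen_ball
  obtain ⟨r, hr, hrs⟩ := Metric.isOpen_iff.1 hop (κ w₀) ⟨w₀, mem_ball_self hRpos, rfl⟩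
  refine ⟨r, hr, fun ε hε => ?_⟩
  rw [Metric.uniformContinuousOn_iff] at hΨu hιu
  obtain ⟨δ₁, hδ₁, H₁⟩ := hΨu ε hε
  obtain ⟨δ, hδ, H⟩ := hιu (δ₁ / (M / R)) (by positivity)
  refine ⟨δ, hδ, fun g hg x₁ hx₁ x₂ hx₂ hd => ?_⟩
  obtain ⟨f, hf, hfM, hfg⟩ := hfac g hg
  obtain ⟨w₁, hw₁, rfl⟩ := hrs hx₁
  obtain ⟨w₂, hw₂, rfl⟩ := hrs hx₂
  have hsub : ball w₀ R ⊆ ball w₀ R' := ball_subset_ball (by linarith)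
  have h1 := H _ ⟨w₁, ball_subset_closedBall hw₁, rfl⟩ _ ⟨w₂, ball_subset_closedBall hw₂, rfl⟩ hd
  rw [hι, hι] at h1
  rw [hfg _ (hsub hw₁), hfg _ (hsub hw₂)]
  refine H₁ _ (by simpa using hfM _ (hsub hw₁)) _ (by simpa using hfM _ (hsub hw₂)) ?_
  have h2 := hLip f hf hfM w₂ hw₂ w₁ hw₁
  rw [dist_eq_norm] at h1 ⊢
  refine h2.trans_lt ?_
  rw [lt_div_iff₀ (by positivity)] at h1
  linarith

/-! rational maps -/

def hom (p : Polynomial ℂ) (n : ℕ) (v : ℂ × ℂ) : ℂ :=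
  ∑ k ∈ Finset.range (n + 1), p.coeff k * v.1 ^ k * v.2 ^ (n - k)

lemma hom_ne (p : Polynomial ℂ) (n : ℕ) (hn : p.natDegree ≤ n) (a b : ℂ) (hb : b ≠ 0) :
    hom p n (a, b) = b ^ n * p.eval (a / b) := by
  rw [Polynomial.eval_eq_sum_range' (Nat.lt_succ_of_le hn), Finset.mul_sum, hom]
  refine Finset.sum_congr rfl fun k hk => ?_
  have hk' : k ≤ n := Nat.lt_succ_iff.1 (Finset.mem_range.1 hk)
  obtain ⟨j, rfl⟩ := Nat.exists_eq_add_of_le hk'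
  simp only [Nat.add_sub_cancel_left, div_pow, pow_add]
  field_simp

lemma hom_zero (p : Polynomial ℂ) (n : ℕ) (a : ℂ) : hom p n (a, 0) = a ^ n * p.coeff n := by
  rw [hom, Finset.sum_range_succ, Finset.sum_eq_zero]
  · simp; ring
  · intro k hk
    have : n - k ≠ 0 := by have := Finset.mem_range.1 hk; omega
    simp [this]

lemma differentiable_hom (p : Polynomial ℂ) (n : ℕ) : Differentiable ℂ (hom p n) := by
  unfold hom
  fun_prop

lemma ratLift_ofC (p q : Polynomial ℂ) (w : ℂ) :
    ratLift p q (ofC w) = mk (p.eval w, q.eval w) := rfl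

lemma ratLift_infty (p q : Polynomial ℂ) (hq : q ≠ 0) (n : ℕ) (hn : max p.natDegree q.natDegree = n) :
    ratLift p q infty = mk (p.coeff n, q.coeff n) := by
  have : ratLift p q infty = (if q.natDegree < p.natDegree then infty
     else if p.natDegree < q.natDegree then ofC 0
     else ofC (p.leadingCoeff / q.leadingCoeff)) := rfl
  rw [this]
  have hq' : q.leadingCoeff ≠ 0 := Polynomial.leadingCoeff_ne_zero.2 hq
  split_ifs with h1 h2
  · have : q.coeff n = 0 := Polynomial.coeff_eq_zero_of_natDegree_lt (by omega)
    rw [this, mk_zero]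
  · have e : n = q.natDegree := by omega
    have : p.coeff n = 0 := Polynomial.coeff_eq_zero_of_natDegree_lt (by omega)
    rw [this, e, Polynomial.coeff_natDegree, mk_ne hq', zero_div]
  · have e : n = q.natDegree := by omega
    have e' : p.natDegree = q.natDegree := by omega
    rw [e, Polynomial.coeff_natDegree, mk_ne hq', ← e', Polynomial.coeff_natDegree]

lemma coeff_ne (p q : Polynomial ℂ) (n : ℕ) (hn1 : 1 ≤ n) (hn : max p.natDegree q.natDegree = n) :
    ((p.coeff n, q.coeff n) : ℂ × ℂ) ≠ 0 := by
  intro h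
  have h1 : p.coeff n = 0 := congrArg Prod.fst h
  have h2 : q.coeff n = 0 := congrArg Prod.snd h
  rcases max_choice p.natDegree q.natDegree with e | e
  · rw [e] at hn
    rw [← hn] at h1
    have : p = 0 := Polynomial.leadingCoeff_eq_zero.1 h1
    simp [this] at hn; omega
  · rw [e] at hn
    rw [← hn] at h2
    have : q = 0 := Polynomial.leadingCoeff_eq_zero.1 h2
    simp [this] at hn; omega

lemma eval_ne (p q : Polynomial ℂ) (hc : IsCoprime p q) (w : ℂ) :
    ((p.eval w, q.eval w) : ℂ × ℂ) ≠ 0 := by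
  intro h
  have h1 : p.eval w = 0 := congrArg Prod.fst h
  have h2 : q.eval w = 0 := congrArg Prod.snd h
  obtain ⟨u, v, e⟩ := hc
  have := congrArg (Polynomial.eval w) e
  simp [h1, h2] at this

lemma sub_ne (p q : Polynomial ℂ) (hc : IsCoprime p q) (n : ℕ) (hn1 : 1 ≤ n)
    (hn : max p.natDegree q.natDegree = n) (c : ℂ) : p - Polynomial.C c * q ≠ 0 := by
  intro h
  have hp : p = Polynomial.C c * q := sub_eq_zero.1 h
  have hu : IsUnit q := by
    refine hc.isUnit_of_dvd' ?_ dvd_rfl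
    rw [hp]; exact Dvd.intro_left _ rfl
  have h0 : q.natDegree = 0 := Polynomial.natDegree_eq_zero_of_isUnit hu
  have : p.natDegree ≤ 0 := by
    rw [hp, ← h0]; exact Polynomial.natDegree_C_mul_le _ _
  omega

lemma isLift_rat (p q : Polynomial ℂ) (hq : q ≠ 0) (hc : IsCoprime p q) (n : ℕ) (hn1 : 1 ≤ n)
    (hn : max p.natDegree q.natDegree = n) :
    IsLift (ratLift p q) (fun v => (hom p n v, hom q n v)) := by
  have hpn : p.natDegree ≤ n := by omega
  have hqn : q.natDegree ≤ n := by omega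
  refine ⟨(differentiable_hom p n).prodMk (differentiable_hom q n), ?_, ?_⟩
  · rintro ⟨a, b⟩ hv h
    have h1 : hom p n (a, b) = 0 := congrArg Prod.fst h
    have h2 : hom q n (a, b) = 0 := congrArg Prod.snd h
    by_cases hb : b = 0
    · subst hb
      have ha : a ≠ 0 := by rintro rfl; exact hv rfl
      rw [hom_zero] at h1 h2
      have := pow_ne_zero n ha
      exact coeff_ne p q n hn1 hn (Prod.ext (by simpa [this, ha] using h1) (by simpa [this, ha] using h2))
    · rw [hom_ne _ _ (by assumption) _ _ hb] at h1 h2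
      have := pow_ne_zero n hb
      exact eval_ne p q hc (a / b) (Prod.ext (by simpa [this, hb] using h1) (by simpa [this, hb] using h2))
  · rintro ⟨a, b⟩ hv
    beta_reduce
    by_cases hb : b = 0
    · subst hb
      have ha : a ≠ 0 := by rintro rfl; exact hv rfl
      rw [hom_zero, hom_zero, mk_smul _ (pow_ne_zero n ha), mk_zero, ratLift_infty p q hq n hn]
    · rw [hom_ne _ _ hpn _ _ hb, hom_ne _ _ hqn _ _ hb, mk_smul _ (pow_ne_zero n hb), mk_ne hb,
        ratLift_ofC]

lemma hol_of_rat {φ : CSphere → CSphere} (hφ : IsNonconstRatMap φ) : Hol φ := by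
  obtain ⟨n, hn1, p, q, ⟨hq, hc, rfl⟩, hn⟩ := hφ
  refine ⟨⟨_, isLift_rat p q hq hc n hn1 hn⟩, fun x => ?_⟩
  have hsub : ∀ (s : Set ℂ), s.Finite → ratLift p q ⁻¹' {x} ⊆ {infty} ∪ ofC '' s →
      (ratLift p q ⁻¹' {x}).Countable := by
    intro s hs hsub
    exact (((countable_singleton _).union (hs.countable.image _))).mono hsub
  rcases cases' x with rfl | ⟨c, rfl⟩
  · refine hsub {w | q.eval w = 0} (Polynomial.finite_setOfPred_isRoot hq) ?_
    intro z hz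
    rcases cases' z with rfl | ⟨w, rfl⟩
    · left; rfl
    · right; refine ⟨w, ?_, rfl⟩
      by_contra hw
      simp only [mem_preimage, ratLift_ofC, mem_singleton_iff] at hz
      rw [mk_ne hw] at hz
      exact ofC_ne_infty _ hz
  · refine hsub {w | (p - Polynomial.C c * q).IsRoot w}
      (Polynomial.finite_setOfPred_isRoot (sub_ne p q hc n hn1 hn c)) ?_
    intro z hz
    rcases cases' z with rfl | ⟨w, rfl⟩
    · left; rfl
    · right; refine ⟨w, ?_, rfl⟩
      simp only [mem_preimage, ratLift_ofC, mem_singleton_iff] at hz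
      by_cases hw : q.eval w = 0
      · rw [hw, mk_zero] at hz; exact (ofC_ne_infty _ hz.symm).elim
      · rw [mk_ne hw] at hz
        have := ofC_inj hz
        rw [div_eq_iff hw] at this
        simp [this]

end SP
end

noncomputable section
open Set Metric Topology Filter MeasureTheory
open scoped ENNReal NNReal ComplexConjugate

namespace SP

open CSphere

def act {m : ℕ} (h : Fin m → CSphere → CSphere) : List (Fin m) → CSphere → CSphere
  | [] => id
  | i :: l => act h l ∘ h i

lemma act_append {m : ℕ} (h : Fin m → CSphere → CSphere) (l l' : List (Fin m)) :
    act h (l ++ l') = act h l' ∘ act h l := by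
  induction l with
  | nil => rfl
  | cons i l ih => simp only [List.cons_append, act, ih]; rfl

lemma foldr_comp (l : List (CSphere → CSphere)) (g : CSphere → CSphere) :
    l.foldr (· ∘ ·) g = l.foldr (· ∘ ·) id ∘ g := by
  induction l with
  | nil => rfl
  | cons f l ih => simp only [List.foldr_cons, ih]; rfl

lemma mem_genFin {m : ℕ} (h : Fin m → CSphere → CSphere) (g : CSphere → CSphere) :
    g ∈ genFin h ↔ ∃ l : List (Fin m), l ≠ [] ∧ g = act h l := by
  constructor
  · rintro ⟨l, hl, hlS, rfl⟩
    have : ∀ l : List (CSphere → CSphere), (∀ a ∈ l, a ∈ range h) →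
        ∃ l' : List (Fin m), l'.length = l.length ∧ l.foldr (· ∘ ·) id = act h l' := by
      intro l
      induction l with
      | nil => intro _; exact ⟨[], rfl, rfl⟩
      | cons f t ih =>
        intro hS
        obtain ⟨t', ht', e⟩ := ih fun a ha => hS a (List.mem_cons_of_mem _ ha)
        obtain ⟨i, rfl⟩ := hS f List.mem_cons_self
        refine ⟨t' ++ [i], by simp [ht'], ?_⟩
        rw [act_append, List.foldr_cons, e]; rfl
    obtain ⟨l', h1, h2⟩ := this l hlS
    refine ⟨l', ?_, h2⟩
    rintro rfl
    exact hl (List.length_eq_zero_iff.1 h1.symm)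
  · rintro ⟨l, hl, rfl⟩
    refine ⟨(l.map h).reverse, by simpa using hl, by simp, ?_⟩
    clear hl
    induction l with
    | nil => rfl
    | cons i l ih =>
      rw [List.map_cons, List.reverse_cons, List.foldr_append, foldr_comp, ← ih]
      rfl

lemma act_hol {m : ℕ} {h : Fin m → CSphere → CSphere} (hh : ∀ i, Hol (h i)) (l : List (Fin m)) :
    Hol (act h l) := by
  induction l with
  | nil => exact Hol.id
  | cons i l ih => exact ih.comp (hh i)

lemma gen_hol {m : ℕ} {h : Fin m → CSphere → CSphere} (hh : ∀ i, Hol (h i)) :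
    ∀ g ∈ genFin h, Hol g := by
  intro g hg
  obtain ⟨l, -, rfl⟩ := (mem_genFin h g).1 hg
  exact act_hol hh l

lemma countable_gen {m : ℕ} (h : Fin m → CSphere → CSphere) : (genFin h).Countable := by
  have : genFin h ⊆ range (act h) := by
    intro g hg
    obtain ⟨l, -, rfl⟩ := (mem_genFin h g).1 hg
    exact ⟨l, rfl⟩
  exact (countable_range _).mono this

section dyn

variable {m : ℕ} {h : Fin m → CSphere → CSphere} {U : Set CSphere}

lemma back (hosc : OpenSetCond h U) (l : List (Fin m)) (x : CSphere) (hx : act h l x ∈ U) :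
    x ∈ U := by
  induction l generalizing x with
  | nil => exact hx
  | cons i l ih => exact hosc.2.2.1 i (ih _ hx)

lemma idx_eq (hosc : OpenSetCond h U) {i j : Fin m} {x : CSphere} (hi : h i x ∈ U)
    (hj : h j x ∈ U) : i = j := by
  by_contra hne
  exact Set.disjoint_left.1 (hosc.2.2.2 hne) hi hj

lemma prefix_of (hosc : OpenSetCond h U) (l l' : List (Fin m)) (x : CSphere)
    (hl : act h l x ∈ U) (hl' : act h l' x ∈ U) (hle : l.length ≤ l'.length) : l <+: l' := by
  induction l generalizing l' x with
  | nil => exact List.nil_prefix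
  | cons i l ih =>
    cases l' with
    | nil => simp at hle
    | cons j l' =>
      have e := idx_eq hosc (back hosc l (h i x) hl) (back hosc l' (h j x) hl')
      subst e
      have := ih l' (h i x) hl hl' (by simpa using hle)
      exact List.cons_prefix_cons.2 ⟨rfl, this⟩

lemma isOpen_fatou (G : Set (CSphere → CSphere)) : IsOpen (rsFatou G) := by
  rw [Metric.isOpen_iff]
  rintro z ⟨r, hr, H⟩
  refine ⟨r, hr, fun w hw => ⟨r - dist w z, by rw [mem_ball] at hw; linarith, fun ε hε => ?_⟩⟩
  obtain ⟨δ, hδ, H⟩ := H ε hε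
  have hs : ball w (r - dist w z) ⊆ ball z r := ball_subset_ball' (by linarith)
  exact ⟨δ, hδ, fun g hg a ha b hb => H g hg a (hs ha) b (hs hb)⟩

lemma fatou_at {G : Set (CSphere → CSphere)} {z : CSphere} (hz : z ∈ rsFatou G) {ε : ℝ}
    (hε : 0 < ε) : ∃ δ > 0, ∀ g ∈ G, ∀ v, dist v z < δ → dist (g v) (g z) < ε := by
  obtain ⟨r, hr, H⟩ := hz
  obtain ⟨δ, hδ, H⟩ := H ε hε
  refine ⟨min r δ, lt_min hr hδ, fun g hg v hv => ?_⟩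
  exact H g hg v (hv.trans_le (min_le_left _ _)) z (mem_ball_self hr) (hv.trans_le (min_le_right _ _))

lemma exists_lb (hm : 0 < m) (f : Fin m → ℝ) (hf : ∀ j, 0 < f j) : ∃ δ > 0, ∀ j, δ ≤ f j := by
  haveI : Nonempty (Fin m) := ⟨⟨0, hm⟩⟩
  obtain ⟨j, hj⟩ := Finite.exists_min f
  exact ⟨f j, hf j, hj⟩

lemma julia_step (hm : 0 < m) (hh : ∀ i, Hol (h i)) (x : CSphere)
    (hx : ∀ j, h j x ∈ rsFatou (genFin h)) : x ∈ rsFatou (genFin h) := by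
  choose r hr H using hx
  have h1 : ∀ j, ∃ s > 0, ∀ v, dist v x < s → dist (h j v) (h j x) < r j := fun j =>
    Metric.continuousAt_iff.1 (hh j).continuous.continuousAt (r j) (hr j)
  choose s hs Hs using h1
  obtain ⟨s₀, hs₀, hs₀le⟩ := exists_lb hm s hs
  refine ⟨s₀, hs₀, fun ε hε => ?_⟩
  choose d hd Hd using fun j => H j ε hε
  have hu : ∀ j, ∃ t > 0, ∀ a b, dist a b < t → dist (h j a) (h j b) < min ε (d j) := fun j => by
    have := CompactSpace.uniformContinuous_of_continuous (hh j).continuous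
    rw [Metric.uniformContinuous_iff] at this
    obtain ⟨t, ht, T⟩ := this _ (lt_min hε (hd j))
    exact ⟨t, ht, fun a b hab => T hab⟩
  choose t ht T using hu
  obtain ⟨t₀, ht₀, ht₀le⟩ := exists_lb hm t ht
  refine ⟨t₀, ht₀, fun g hg w₁ hw₁ w₂ hw₂ hw => ?_⟩
  obtain ⟨l, hl, rfl⟩ := (mem_genFin h g).1 hg
  cases l with
  | nil => exact (hl rfl).elim
  | cons j l =>
    have hT := T j w₁ w₂ (hw.trans_le (ht₀le j))
    by_cases hl0 : l = []
    · subst hl0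
      exact hT.trans_le (min_le_left _ _)
    · refine Hd j (act h l) ((mem_genFin h _).2 ⟨l, hl0, rfl⟩) (h j w₁) ?_ (h j w₂) ?_
        (hT.trans_le (min_le_right _ _))
      · exact Hs j _ (lt_of_lt_of_le hw₁ (hs₀le j))
      · exact Hs j _ (lt_of_lt_of_le hw₂ (hs₀le j))

lemma julia_sub (hh : ∀ i, Hol (h i)) (hosc : OpenSetCond h U) :
    rsJulia (genFin h) ⊆ closure U := by
  have : (closure U)ᶜ ⊆ rsFatou (genFin h) := by
    refine montel _ (gen_hol hh) _ U isClosed_closure.isOpen_compl hosc.2.1 hosc.1 ?_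
    intro g hg x hx hgx
    obtain ⟨l, -, rfl⟩ := (mem_genFin h g).1 hg
    exact hx (subset_closure (back hosc l x hgx))
  intro x hx
  by_contra hc
  exact hx (this hc)

lemma inter_nonempty (hh : ∀ i, Hol (h i)) (hosc : OpenSetCond h U)
    (hneq : rsJulia (genFin h) ≠ closure U) : (U ∩ rsFatou (genFin h)).Nonempty := by
  by_contra hcon
  rw [not_nonempty_iff_eq_empty] at hcon
  apply hneq
  refine (julia_sub hh hosc).antisymm ?_
  refine closure_minimal ?_ (isOpen_fatou _).isClosed_compl
  intro x hx hF
  have : x ∈ U ∩ rsFatou (genFin h) := ⟨hx, hF⟩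
  rw [hcon] at this
  exact this

lemma dense_fatou (hm : 0 < m) (hh : ∀ i, Hol (h i)) (hosc : OpenSetCond h U)
    (hneq : rsJulia (genFin h) ≠ closure U) (B : Set CSphere) (hB : IsOpen B)
    (hBn : B.Nonempty) : (B ∩ rsFatou (genFin h)).Nonempty := by
  by_contra hcon
  rw [not_nonempty_iff_eq_empty] at hcon
  have hBJ : ∀ x ∈ B, x ∉ rsFatou (genFin h) := by
    intro x hx hF
    have : x ∈ B ∩ rsFatou (genFin h) := ⟨hx, hF⟩
    rw [hcon] at this
    exact this
  have hUF := inter_nonempty hh hosc hneq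
  have hUFo : IsOpen (U ∩ rsFatou (genFin h)) := hosc.2.1.inter (isOpen_fatou _)
  obtain ⟨g, hg, x, hx, hgx⟩ : ∃ g ∈ genFin h, ∃ x ∈ B, g x ∈ U ∩ rsFatou (genFin h) := by
    by_contra hno
    push Not at hno
    have := montel _ (gen_hol hh) B _ hB hUFo hUF hno
    obtain ⟨x, hx⟩ := hBn
    exact hBJ x hx (this hx)
  obtain ⟨l, -, rfl⟩ := (mem_genFin h g).1 hg
  have hd : Dense (⋂ l : List (Fin m), act h l ⁻¹' (frontier U)ᶜ) := by
    refine dense_iInter_of_isOpen (fun l => ?_) (fun l => ?_)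
    · exact isClosed_frontier.isOpen_compl.preimage (act_hol hh l).continuous
    · have : Dense ((frontier U)ᶜ) := by
        rw [← interior_eq_empty_iff_dense_compl]
        rw [← frontier_compl]
        exact interior_frontier hosc.2.1.isClosed_compl
      exact this.preimage (act_hol hh l).isOpenMap
  obtain ⟨x, ⟨hxB, hxl⟩, hxd⟩ := hd.inter_open_nonempty
    (B ∩ act h l ⁻¹' (U ∩ rsFatou (genFin h)))
    (hB.inter (hUFo.preimage (act_hol hh l).continuous)) ⟨x, hx, hgx⟩
  have key : ∀ (l : List (Fin m)) (x : CSphere), (∀ l', act h l' x ∉ frontier U) →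
      x ∉ rsFatou (genFin h) → act h l x ∈ U → act h l x ∉ rsFatou (genFin h) := by
    intro l
    induction l with
    | nil => intro x _ hx _; exact hx
    | cons i l ih =>
      intro x hfr hx hU
      have hj : ∃ j, h j x ∉ rsFatou (genFin h) := by
        by_contra hno
        push Not at hno
        exact hx (julia_step hm hh x hno)
      obtain ⟨j, hj⟩ := hj
      have hjU : h j x ∈ U := by
        have h1 : h j x ∈ closure U := julia_sub hh hosc hj
        by_contra h2
        exact hfr [j] ⟨h1, by rwa [hosc.2.1.interior_eq]⟩
      have e := idx_eq hosc (back hosc l (h i x) hU) hjU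
      subst e
      exact ih (h i x) (fun l' => hfr (i :: l')) hj hU
  refine key l x (fun l' => ?_) (hBJ x hxB) hxl.1 hxl.2
  exact mem_iInter.1 hxd l'

/-- there is a non recurrent point -/
lemma nonrec_of_pair (hm : 0 < m) (hh : ∀ i, Hol (h i)) (hosc : OpenSetCond h U)
    (hneq : rsJulia (genFin h) ≠ closure U) (i j : Fin m) (a₁ a₂ : CSphere) (hne : a₁ ≠ a₂)
    (he : h i a₁ = h j a₂) (hU : h i a₁ ∈ U) :
    ∃ x ∈ U ∩ rsFatou (genFin h), ∃ ε > 0, ∀ l : List (Fin m), l ≠ [] →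
      ε ≤ dist (act h l x) x := by
  -- perturb into Fatou set
  obtain ⟨y₁, y₂, hy, hF₁, hF₂, hyy, hyU⟩ : ∃ y₁ y₂ : CSphere, y₁ ≠ y₂ ∧ y₁ ∈ rsFatou (genFin h) ∧
      y₂ ∈ rsFatou (genFin h) ∧ h i y₁ = h j y₂ ∧ h i y₁ ∈ U := by
    obtain ⟨N₁, N₂, ho₁, ho₂, hm₁, hm₂, hdis⟩ := t2_separation hne
    have hO : IsOpen (h i '' N₁ ∩ h j '' N₂ ∩ U) :=
      (((hh i).isOpenMap _ ho₁).inter ((hh j).isOpenMap _ ho₂)).inter hosc.2.1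
    obtain ⟨y₁, ⟨hyN, hyO⟩, hyF⟩ := dense_fatou hm hh hosc hneq
      (N₁ ∩ h i ⁻¹' (h i '' N₁ ∩ h j '' N₂ ∩ U))
      (ho₁.inter (hO.preimage (hh i).continuous))
      ⟨a₁, hm₁, ⟨⟨a₁, hm₁, rfl⟩, ⟨a₂, hm₂, he.symm⟩⟩, hU⟩
    have hB₁ : IsOpen (N₁ ∩ h i ⁻¹' (h i '' N₁ ∩ h j '' N₂ ∩ U) ∩ rsFatou (genFin h)) :=
      (ho₁.inter (hO.preimage (hh i).continuous)).inter (isOpen_fatou _)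
    have hB₁' := (hh i).isOpenMap _ hB₁
    obtain ⟨b, hb, hby⟩ := hyO.1.2
    have hyO' := hyO
    · obtain ⟨y₂, ⟨hyN₂, hy₂⟩, hyF₂⟩ := dense_fatou hm hh hosc hneq
        (N₂ ∩ h j ⁻¹' (h i '' (N₁ ∩ h i ⁻¹' (h i '' N₁ ∩ h j '' N₂ ∩ U) ∩ rsFatou (genFin h))))
        (ho₂.inter (hB₁'.preimage (hh j).continuous))
        ⟨b, hb, ⟨y₁, ⟨⟨hyN, hyO'⟩, hyF⟩, hby.symm⟩⟩
      obtain ⟨z, ⟨⟨hz1, hz2⟩, hz3⟩, hz4⟩ := hy₂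
      refine ⟨z, y₂, ?_, hz3, hyF₂, hz4, hz2.2⟩
      rintro rfl
      exact Set.disjoint_left.1 hdis hz1 hyN₂
  by_contra hcon
  push Not at hcon
  have hrec : ∀ x ∈ U ∩ rsFatou (genFin h), ∀ ε > 0, ∃ l : List (Fin m), l ≠ [] ∧
      dist (act h l x) x < ε := hcon
  have hyU₁ : y₁ ∈ U := hosc.2.2.1 i hyU
  have hyU₂' : h j y₂ ∈ U := hyy ▸ hyU
  have hyU₂ : y₂ ∈ U := hosc.2.2.1 j hyU₂'
  obtain ⟨e₁, he₁, hs₁⟩ := Metric.isOpen_iff.1 hosc.2.1 y₁ hyU₁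
  obtain ⟨e₂, he₂, hs₂⟩ := Metric.isOpen_iff.1 hosc.2.1 y₂ hyU₂
  have hd : 0 < dist y₁ y₂ := dist_pos.2 hy
  obtain ⟨ε, hε, hεd, hε₁, hε₂⟩ : ∃ ε > 0, 4 * ε < dist y₁ y₂ ∧ 2 * ε < e₁ ∧ 2 * ε < e₂ := by
    refine ⟨min (dist y₁ y₂ / 8) (min (e₁ / 4) (e₂ / 4)), by positivity, ?_, ?_, ?_⟩
    · have := min_le_left (dist y₁ y₂ / 8) (min (e₁ / 4) (e₂ / 4)); linarith
    · have := (min_le_right (dist y₁ y₂ / 8) (min (e₁ / 4) (e₂ / 4))).trans (min_le_left _ _)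
      linarith
    · have := (min_le_right (dist y₁ y₂ / 8) (min (e₁ / 4) (e₂ / 4))).trans (min_le_right _ _)
      linarith
  obtain ⟨δ, hδ, Hδ⟩ := fatou_at hF₂ hε
  obtain ⟨l₂, hl₂, hr₂⟩ := hrec y₂ ⟨hyU₂, hF₂⟩ (min δ ε) (lt_min hδ hε)
  have hU₂ : act h l₂ y₂ ∈ U := hs₂ (by
    rw [mem_ball]; have := hr₂.trans_le (min_le_right _ _); linarith)
  cases l₂ with
  | nil => exact hl₂ rfl
  | cons j' b =>
    have e := idx_eq hosc (back hosc b (h j' y₂) hU₂) hyU₂'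
    subst e
    have hr₂' : dist (act h b (h j' y₂)) y₂ < min δ ε := hr₂
    have hcont : ContinuousAt (act h b ∘ h i) y₁ :=
      ((act_hol hh b).continuous.comp (hh i).continuous).continuousAt
    obtain ⟨η, hη, Hη⟩ := Metric.continuousAt_iff.1 hcont ε hε
    obtain ⟨l₁, hl₁, hr₁⟩ := hrec y₁ ⟨hyU₁, hF₁⟩ (min η ε) (lt_min hη hε)
    have hU₁ : act h l₁ y₁ ∈ U := hs₁ (by
      rw [mem_ball]; have := hr₁.trans_le (min_le_right _ _); linarith)
    cases l₁ with
    | nil => exact hl₁ rfl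
    | cons i' a =>
      have e := idx_eq hosc (back hosc a (h i' y₁) hU₁) hyU
      subst e
      have hr₁' : dist (act h a (h i' y₁)) y₁ < min η ε := hr₁
      set y := h i' y₁ with hydef
      rw [← hyy] at hr₂'
      have hW1 : dist (act h (b ++ j' :: a) y) y₁ < 2 * ε := by
        rw [act_append]
        have h1 := Hδ (act h (j' :: a)) ((mem_genFin h _).2 ⟨_, List.cons_ne_nil _ _, rfl⟩)
          (act h b y) (hr₂'.trans_le (min_le_left _ _))
        have h2 : act h (j' :: a) y₂ = act h a y := by
          show act h a (h j' y₂) = _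
          rw [← hyy]
        rw [h2] at h1
        have h3 := hr₁'.trans_le (min_le_right _ _)
        have := dist_triangle ((act h (j' :: a) ∘ act h b) y) (act h a y) y₁
        simp only [Function.comp] at this ⊢
        linarith
      have hW2 : dist (act h (a ++ i' :: b) y) y₂ < 2 * ε := by
        rw [act_append]
        have h1 := Hη (hr₁'.trans_le (min_le_left _ _))
        have h3 := hr₂'.trans_le (min_le_right _ _)
        have h4 : (act h (i' :: b) ∘ act h a) y = (act h b ∘ h i') (act h a y) := rfl
        have h5 : (act h b ∘ h i') y₁ = act h b y := rfl
        rw [h5] at h1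
        rw [h4]
        have := dist_triangle ((act h b ∘ h i') (act h a y)) (act h b y) y₂
        linarith
      have hpre := prefix_of hosc (b ++ j' :: a) (a ++ i' :: b) y
        (hs₁ (by rw [mem_ball]; linarith)) (hs₂ (by rw [mem_ball]; linarith))
        (by simp; omega)
      have heq := hpre.eq_of_length (by simp; omega)
      rw [heq] at hW1
      have := dist_triangle_left y₁ y₂ (act h (a ++ i' :: b) y)
      linarith

/-- wandering open set -/
lemma wander (hosc : OpenSetCond h U) (x : CSphere) (hx : x ∈ U ∩ rsFatou (genFin h)) (ε : ℝ)
    (hε : 0 < ε) (hrec : ∀ l : List (Fin m), l ≠ [] → ε ≤ dist (act h l x) x) :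
    ∃ (c : ℂ) (R : ℝ), 0 < R ∧ ofC '' ball c R ⊆ U ∩ rsFatou (genFin h) ∧
      ∀ l : List (Fin m), l ≠ [] → ∀ v ∈ ofC '' ball c R, act h l v ∉ ofC '' ball c R := by
  obtain ⟨δ, hδ, H⟩ := fatou_at hx.2 (half_pos hε)
  have hVo : IsOpen (ball x (min δ (ε / 2)) ∩ (U ∩ rsFatou (genFin h))) :=
    isOpen_ball.inter (hosc.2.1.inter (isOpen_fatou _))
  obtain ⟨c, hc⟩ := exists_ofC_mem hVo ⟨x, mem_ball_self (by positivity), hx⟩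
  obtain ⟨R, hR, hRs⟩ := Metric.isOpen_iff.1 (hVo.preimage continuous_ofC) c hc
  refine ⟨c, R, hR, ?_, ?_⟩
  · rintro _ ⟨w, hw, rfl⟩; exact (hRs hw).2
  · rintro l hl _ ⟨w, hw, rfl⟩ ⟨w', hw', e⟩
    have h1 := (hRs hw).1
    have h2 := (hRs hw').1
    rw [e] at h2
    have h3 := H _ ((mem_genFin h _).2 ⟨l, hl, rfl⟩) (ofC w) (lt_of_lt_of_le h1 (min_le_left _ _))
    have h4 := hrec l hl
    have h5 : dist (act h l (ofC w)) x < ε / 2 := lt_of_lt_of_le h2 (min_le_right _ _)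
    have := dist_triangle_left (act h l x) x (act h l (ofC w))
    linarith

/-- disjointness of preimages -/
lemma disj_pre (hosc : OpenSetCond h U) (V : Set CSphere) (hVU : V ⊆ U)
    (hw : ∀ l : List (Fin m), l ≠ [] → ∀ v ∈ V, act h l v ∉ V) (g g' : CSphere → CSphere)
    (hg : g ∈ genFin h) (hg' : g' ∈ genFin h) (hne : g ≠ g') :
    Disjoint (g ⁻¹' V) (g' ⁻¹' V) := by
  obtain ⟨l, -, rfl⟩ := (mem_genFin h g).1 hg
  obtain ⟨l', -, rfl⟩ := (mem_genFin h g').1 hg'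
  have key : ∀ l l' : List (Fin m), act h l ≠ act h l' → l.length ≤ l'.length → ∀ y,
      act h l y ∈ V → act h l' y ∉ V := by
    intro l l' hne hle y hy hy'
    obtain ⟨u, rfl⟩ := prefix_of hosc l l' y (hVU hy) (hVU hy') hle
    have hu : u ≠ [] := by rintro rfl; simp at hne
    rw [act_append] at hy'
    exact hw u hu _ hy hy'
  rw [Set.disjoint_left]
  intro y hy hy'
  rcases le_total l.length l'.length with hle | hle
  · exact key l l' hne hle y hy hy'
  · exact key l' l hne.symm hle y hy' hy

end dyn

end SP
end

noncomputable section
open Set Metric Topology Filter MeasureTheory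
open scoped ENNReal NNReal ComplexConjugate

namespace SP

open CSphere

lemma exists_avoid {O : Set CSphere} (ho : IsOpen O) (hn : O.Nonempty) {S : Set ℂ}
    (hS : S.Finite) : ∃ w, ofC w ∈ O ∧ w ∉ S := by
  obtain ⟨w, hw⟩ := exists_ofC_mem ho hn
  have hinf : (ofC ⁻¹' O).Infinite :=
    infinite_of_mem_nhds w ((ho.preimage continuous_ofC).mem_nhds hw)
  obtain ⟨v, hv, hvS⟩ := hinf.exists_notMem_finite hS
  exact ⟨v, hv, hvS⟩

open Polynomial in
lemma exists_pair (p q : Polynomial ℂ) (hc : IsCoprime p q) (n : ℕ) (hn2 : 2 ≤ n)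
    (hn : max p.natDegree q.natDegree = n) {O : Set CSphere} (ho : IsOpen O) (hne : O.Nonempty) :
    ∃ a₁ a₂ : CSphere, a₁ ≠ a₂ ∧ ratLift p q a₁ = ratLift p q a₂ ∧ ratLift p q a₁ ∈ O := by
  have hW : wronskian p q ≠ 0 := by
    intro h0
    obtain ⟨h1, h2⟩ := (IsCoprime.wronskian_eq_zero_iff hc).1 h0
    have e1 := derivative_eq_zero.1 h1
    have e2 := derivative_eq_zero.1 h2
    rw [e1, e2] at hn
    simp at hn
    omega
  have hS : ({p.coeff n / q.coeff n} ∪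
      ((fun z => p.eval z / q.eval z) '' ((wronskian p q).roots.toFinset : Set ℂ))).Finite :=
    (finite_singleton _).union ((Finset.finite_toSet _).image _)
  obtain ⟨c, hcO, hcS⟩ := exists_avoid ho hne hS
  set F := p - C c * q with hF
  have hF0 : F ≠ 0 := sub_ne p q hc n (by omega) hn c
  have hq0 : ∀ z, F.eval z = 0 → q.eval z ≠ 0 := by
    intro z hz hq
    apply eval_ne p q hc z
    simp [hF, hq] at hz
    rw [hz, hq]; rfl
  have hpc : ∀ z, F.eval z = 0 → p.eval z = c * q.eval z := by
    intro z hz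
    simp [hF] at hz
    exact sub_eq_zero.1 hz
  have hdeg : F.natDegree = n := by
    apply le_antisymm
    · refine (natDegree_sub_le _ _).trans (max_le ?_ ?_)
      · exact hn ▸ le_max_left _ _
      · exact (natDegree_C_mul_le _ _).trans (hn ▸ le_max_right _ _)
    · apply le_natDegree_of_ne_zero
      intro h0
      have h1 : p.coeff n = c * q.coeff n := by
        simp [hF] at h0
        exact sub_eq_zero.1 h0
      by_cases h2 : q.coeff n = 0
      · apply coeff_ne p q n (by omega) hn
        rw [h1, h2]; simp
      · apply hcS
        left
        rw [mem_singleton_iff, h1, mul_div_cancel_right₀ _ h2]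
  have hnd : F.roots.Nodup := by
    rw [Multiset.nodup_iff_count_le_one]
    intro z
    rw [count_roots]
    by_contra hlt
    push Not at hlt
    obtain ⟨h1, h2⟩ := (one_lt_rootMultiplicity_iff_isRoot hF0).1 hlt
    have e1 := hpc z h1
    have e2 : p.derivative.eval z = c * q.derivative.eval z := by
      have : F.derivative.eval z = 0 := h2
      simp [hF] at this
      exact sub_eq_zero.1 this
    apply hcS
    right
    refine ⟨z, ?_, ?_⟩
    · simp only [Finset.mem_coe, Multiset.mem_toFinset]
      rw [mem_roots hW]
      simp [wronskian, IsRoot, e1, e2]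
      ring
    · show p.eval z / q.eval z = c
      rw [e1, mul_div_cancel_right₀ _ (hq0 z h1)]
  have hcard : F.roots.card = n := by
    rw [← hdeg]
    exact (splits_iff_card_roots.1 (IsAlgClosed.splits F))
  have h2 : 1 < F.roots.toFinset.card := by
    rw [Multiset.toFinset_card_of_nodup hnd, hcard]; omega
  obtain ⟨z₁, hz₁, z₂, hz₂, hne⟩ := Finset.one_lt_card.1 h2
  have hval : ∀ z ∈ F.roots.toFinset, ratLift p q (ofC z) = ofC c := by
    intro z hz
    have hz' : F.eval z = 0 := by
      rw [Multiset.mem_toFinset, mem_roots hF0] at hz; exact hz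
    rw [ratLift_ofC, mk_ne (hq0 z hz'), hpc z hz', mul_div_cancel_right₀ _ (hq0 z hz')]
  refine ⟨ofC z₁, ofC z₂, fun h => hne (ofC_inj h), ?_, ?_⟩
  · rw [hval z₁ hz₁, hval z₂ hz₂]
  · rw [hval z₁ hz₁]; exact hcO

lemma affine_far (α β : ℂ) (hcase : (α = 1 ∧ β ≠ 0) ∨ ‖α‖ ≠ 1) : ∃ p : ℂ, ∀ u, u ≠ p →
    ∃ d > 0, ∀ n : ℕ, 1 ≤ n → d ≤ ‖(fun z => α * z + β)^[n] u - u‖ := by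
  rcases hcase with ⟨rfl, hβ⟩ | hα
  · refine ⟨0, fun u _ => ⟨‖β‖, norm_pos_iff.2 hβ, fun n hn => ?_⟩⟩
    have : ∀ n : ℕ, (fun z => 1 * z + β)^[n] u = u + n * β := by
      intro n
      induction n with
      | zero => simp
      | succ n ih => rw [Function.iterate_succ_apply', ih]; push_cast; ring
    rw [this, add_sub_cancel_left, norm_mul, Complex.norm_natCast]
    have h1 : (1:ℝ) ≤ n := by exact_mod_cast hn
    nlinarith [norm_nonneg β]
  · have h1 : 1 - α ≠ 0 := by
      intro h
      apply hα
      rw [← sub_eq_zero.1 h]; simp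
    set p := β / (1 - α) with hp
    have hpp : β = p * (1 - α) := by rw [hp, div_mul_cancel₀ _ h1]
    refine ⟨p, fun u hu => ⟨|‖α‖ - 1| * ‖u - p‖, ?_, fun n hn => ?_⟩⟩
    · exact mul_pos (abs_pos.2 (sub_ne_zero.2 hα)) (norm_pos_iff.2 (sub_ne_zero.2 hu))
    have : ∀ n : ℕ, (fun z => α * z + β)^[n] u - u = (α ^ n - 1) * (u - p) := by
      intro n
      induction n with
      | zero => simp
      | succ n ih =>
        rw [Function.iterate_succ_apply', eq_add_of_sub_eq ih, hpp]; ring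
    rw [this, norm_mul]
    refine mul_le_mul_of_nonneg_right ?_ (norm_nonneg _)
    have h2 : |‖α‖ ^ n - 1| ≤ ‖α ^ n - 1‖ := by
      have := abs_norm_sub_norm_le (α ^ n) 1
      simpa using this
    refine le_trans ?_ h2
    rcases lt_or_gt_of_ne hα with hlt | hgt
    · have h3 : ‖α‖ ^ n ≤ ‖α‖ := pow_le_of_le_one (norm_nonneg _) hlt.le (by omega)
      rw [abs_of_neg (by linarith), abs_of_neg (by linarith)]; linarith
    · have h3 : ‖α‖ ≤ ‖α‖ ^ n := le_self_pow₀ hgt.le (by omega)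
      rw [abs_of_pos (by linarith), abs_of_pos (by linarith)]; linarith

lemma nonrec_conj (φ N : CSphere → CSphere) (hN : Hol N)
    (hinj : ∀ u v, N (ofC u) = N (ofC v) → u = v) (α β : ℂ)
    (hcase : (α = 1 ∧ β ≠ 0) ∨ ‖α‖ ≠ 1) (hconj : ∀ u, φ (N (ofC u)) = N (ofC (α * u + β)))
    {O : Set CSphere} (ho : IsOpen O) (hne : O.Nonempty) :
    ∃ x ∈ O, ∃ ε > 0, ∀ n : ℕ, 1 ≤ n → ε ≤ dist (φ^[n] x) x := by
  obtain ⟨p, hp⟩ := affine_far α β hcase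
  obtain ⟨y, hy⟩ := hne
  obtain ⟨y', rfl⟩ := hN.surjective y
  obtain ⟨u, hu, hup⟩ := exists_avoid (ho.preimage hN.continuous) ⟨y', hy⟩ (finite_singleton p)
  obtain ⟨d, hd, H⟩ := hp u hup
  have hop : IsOpen (N '' (ofC '' ball u d)) :=
    hN.isOpenMap _ (isOpenEmbedding_ofC.isOpenMap _ isOpen_ball)
  obtain ⟨ε, hε, hs⟩ := Metric.isOpen_iff.1 hop (N (ofC u))
    ⟨_, ⟨u, mem_ball_self hd, rfl⟩, rfl⟩
  refine ⟨N (ofC u), hu, ε, hε, fun n hn => ?_⟩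
  by_contra hlt
  push Not at hlt
  have hit : ∀ n : ℕ, φ^[n] (N (ofC u)) = N (ofC ((fun z => α * z + β)^[n] u)) := by
    intro n
    induction n with
    | zero => rfl
    | succ n ih => rw [Function.iterate_succ_apply', ih, hconj, Function.iterate_succ_apply']
  rw [hit] at hlt
  obtain ⟨_, ⟨v, hv, rfl⟩, e⟩ := hs hlt
  have := hinj _ _ e
  rw [mem_ball, dist_eq_norm, this] at hv
  exact absurd (H n hn) (not_le.2 hv)

lemma sphInv_eq : sphInv = sw := by
  ext1 z
  rcases cases' z with rfl | ⟨w, rfl⟩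
  · rw [sphInv, ratLift_infty _ _ Polynomial.X_ne_zero 1 (by simp)]
    simp [sw, Polynomial.coeff_one]
  · rw [sphInv, ratLift_ofC, sw_ofC]
    simp [ofI]

open Polynomial in
lemma mobius_nonrec (φ : CSphere → CSphere) (hφ : IsMobius φ) (hid : φ ≠ id)
    (hell : ¬ IsEllipticMobius φ) {O : Set CSphere} (ho : IsOpen O) (hne : O.Nonempty) :
    ∃ x ∈ O, ∃ ε > 0, ∀ n : ℕ, 1 ≤ n → ε ≤ dist (φ^[n] x) x := by
  have hφ' := hφ
  obtain ⟨p, q, ⟨hq, hc, rfl⟩, hn⟩ := hφ'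
  have hl := isLift_rat p q hq hc 1 le_rfl hn
  have hpn : p.natDegree ≤ 1 := hn ▸ le_max_left _ _
  have hqn : q.natDegree ≤ 1 := hn ▸ le_max_right _ _
  have hev := eval_ne p q hc
  have hco := coeff_ne p q 1 le_rfl hn
  have hpe : ∀ z, p.eval z = p.coeff 1 * z + p.coeff 0 := by
    intro z; conv_lhs => rw [eq_X_add_C_of_natDegree_le_one hpn]
    simp
  have hqe : ∀ z, q.eval z = q.coeff 1 * z + q.coeff 0 := by
    intro z; conv_lhs => rw [eq_X_add_C_of_natDegree_le_one hqn]
    simp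
  have hmk : ∀ x y : ℂ, ((x, y) : ℂ × ℂ) ≠ 0 → ratLift p q (mk (x, y)) =
      mk (p.coeff 1 * x + p.coeff 0 * y, q.coeff 1 * x + q.coeff 0 * y) := by
    intro x y hxy
    rw [← hl.2.2 _ hxy]
    congr 1
    simp [hom, Finset.sum_range_succ]
    constructor <;> ring
  have hqz : ¬ (q.coeff 1 = 0 ∧ q.coeff 0 = 0) := by
    rintro ⟨h1, h2⟩
    apply hq
    rw [eq_X_add_C_of_natDegree_le_one hqn, h1, h2]; simp
  generalize p.coeff 1 = a at *
  generalize p.coeff 0 = b at *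
  generalize q.coeff 1 = c at *
  generalize q.coeff 0 = d at *
  set φ := ratLift p q with hφdef
  have hne0 : ∀ d, (∃ z, φ z = z ∧ derivFixEq φ z d) → ‖d‖ ≠ 1 ∨ d = 1 := by
    rintro d ⟨z, h1, h2⟩
    by_contra hcon
    push Not at hcon
    exact hell ⟨hφ, z, d, h1, h2, hcon.1, hcon.2⟩
  by_cases hc0 : c = 0
  · subst hc0
    have ha : a ≠ 0 := fun h => hco (by rw [h]; rfl)
    have hd : d ≠ 0 := fun h => hqz ⟨rfl, h⟩
    have hfix : φ infty = infty := by
      have := hmk 1 0 (by simp [Prod.ext_iff])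
      rw [mk_zero] at this
      rw [this]; simp [mk_zero]
    have hder : derivFixEq φ infty (d / a) := by
      right
      refine ⟨rfl, fun w => d * w / (a + b * w), ?_, ?_⟩
      · have hcont : ContinuousAt (fun w : ℂ => a + b * w) 0 := by fun_prop
        have : ∀ᶠ w in 𝓝 (0:ℂ), a + b * w ≠ 0 := hcont.eventually_ne (by simpa using ha)
        filter_upwards [this] with w hw
        rw [sphInv_eq, sw_ofC, ofI, hmk _ _ (ne_zero_right w), sw_mk _ _ ?_]
        · simp only [zero_mul, zero_add, mul_one]
          rw [mk_ne hw]
        · intro h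
          have := congrArg Prod.fst h
          simp at this
          exact hw this
      · have h1 : HasDerivAt (fun w : ℂ => d * w) d 0 := by
          simpa using (hasDerivAt_id (0:ℂ)).const_mul d
        have h2 : HasDerivAt (fun w : ℂ => a + b * w) b 0 := by
          simpa using ((hasDerivAt_id (0:ℂ)).const_mul b).const_add a
        refine HasDerivAt.congr_deriv (h1.div h2 (by simpa using ha)) ?_
        simp only [mul_zero, add_zero, zero_mul, sub_zero]
        field_simp
    have hconj : ∀ u, φ (id (ofC u)) = id (ofC (a / d * u + b / d)) := by
      intro u
      simp only [id]
      rw [← mk_one u, hmk _ _ (ne_zero_left u), mk_ne (by simpa using hd)]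
      congr 1
      rw [zero_mul, zero_add, mul_one, mul_one]
      field_simp
    refine nonrec_conj φ id Hol.id (fun u v h => ofC_inj h) (a / d) (b / d) ?_ hconj ho hne
    rcases hne0 _ ⟨infty, hfix, hder⟩ with h1 | h1
    · right
      intro h2
      apply h1
      rw [norm_div] at *
      rw [div_eq_one_iff_eq (norm_ne_zero_iff.2 hd)] at h2
      rw [h2, div_self (norm_ne_zero_iff.2 hd)]
    · left
      rw [div_eq_one_iff_eq ha] at h1
      subst h1
      refine ⟨div_self ha, ?_⟩
      intro h2
      rw [div_eq_zero_iff] at h2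
      have hb : b = 0 := h2.resolve_right ha
      subst hb
      apply hid
      ext1 z
      conv_lhs => rw [← mk_rep z]
      have := hmk (rep z).1 (rep z).2 (rep_ne z)
      rw [this, ← mk_rep z]
      simp only [zero_mul, add_zero, zero_add, mk_rep]
      rw [mk_smul _ ha]; exact mk_rep z
  · obtain ⟨z₀, hz₀⟩ : ∃ z₀ : ℂ, c * z₀ ^ 2 + (d - a) * z₀ - b = 0 := by
      have hdeg : (C c * X ^ 2 + C (d - a) * X + C (-b) : ℂ[X]).degree = 2 :=
        degree_quadratic hc0
      obtain ⟨z, hz⟩ := IsAlgClosed.exists_root _ (by rw [hdeg]; decide)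
      refine ⟨z, ?_⟩
      simp [IsRoot] at hz
      linear_combination hz
    set e := c * z₀ + d with he
    have haz : a * z₀ + b = z₀ * e := by rw [he]; linear_combination -hz₀
    have he0 : e ≠ 0 := by
      intro h0
      apply hev z₀
      rw [hpe, hqe, haz, ← he, h0]; simp
    have hD : a * d - b * c ≠ 0 := by
      intro h0
      apply hev (-d / c)
      rw [hpe, hqe]
      have h1 : a * (-d / c) + b = 0 := by field_simp; linear_combination -h0
      have h2 : c * (-d / c) + d = 0 := by field_simp; ring
      rw [h1, h2]; rfl
    set κ := a - z₀ * c with hκ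
    have hκe : κ * e = a * d - b * c := by rw [hκ, he]; linear_combination -c * hz₀
    have hκ0 : κ ≠ 0 := by
      intro h0; rw [h0, zero_mul] at hκe; exact hD hκe.symm
    have hfix : φ (ofC z₀) = ofC z₀ := by
      rw [← mk_one z₀, hmk _ _ (ne_zero_left _), mul_one, mul_one, haz, ← he, mk_ne he0,
        mul_div_cancel_right₀ _ he0, mk_one]
    have hder : derivFixEq φ (ofC z₀) (κ / e) := by
      left
      refine ⟨z₀, rfl, fun w => (a * w + b) / (c * w + d), ?_, ?_⟩
      · have hcont : ContinuousAt (fun w : ℂ => c * w + d) z₀ := by fun_prop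
        have : ∀ᶠ w in 𝓝 z₀, c * w + d ≠ 0 := hcont.eventually_ne he0
        filter_upwards [this] with w hw
        rw [← mk_one w, hmk _ _ (ne_zero_left _), mul_one, mul_one, mk_ne hw]
      · have h1 : HasDerivAt (fun w : ℂ => a * w + b) a z₀ := by
          simpa using ((hasDerivAt_id z₀).const_mul a).add_const b
        have h2 : HasDerivAt (fun w : ℂ => c * w + d) c z₀ := by
          simpa using ((hasDerivAt_id z₀).const_mul c).add_const d
        refine HasDerivAt.congr_deriv (h1.div h2 he0) ?_
        rw [← he, haz, hκ]
        field_simp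
    have hcop : IsCoprime (C z₀ * X + 1 : ℂ[X]) X := ⟨1, -C z₀, by ring⟩
    have hmax : max (C z₀ * X + 1 : ℂ[X]).natDegree (X : ℂ[X]).natDegree = 1 := by
      rw [natDegree_X]
      exact max_eq_right (by compute_degree)
    have hN : Hol (ratLift (C z₀ * X + 1) X) :=
      hol_of_rat ⟨1, le_rfl, _, _, ⟨X_ne_zero, hcop, rfl⟩, hmax⟩
    have hNe : ∀ u, ratLift (C z₀ * X + 1) X (ofC u) = mk (z₀ * u + 1, u) := by
      intro u; rw [ratLift_ofC]; simp
    refine nonrec_conj φ _ hN ?_ (e / κ) (c / κ) ?_ ?_ ho hne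
    · intro u v h
      rw [hNe, hNe] at h
      by_cases hu : u = 0 <;> by_cases hv : v = 0
      · rw [hu, hv]
      · rw [hu, mk_zero, mk_ne hv] at h
        exact (ofC_ne_infty _ h.symm).elim
      · rw [hv, mk_zero, mk_ne hu] at h
        exact (ofC_ne_infty _ h).elim
      · rw [mk_ne hu, mk_ne hv] at h
        have := ofC_inj h
        rw [div_eq_div_iff hu hv] at this
        linear_combination -this
    · rcases hne0 _ ⟨_, hfix, hder⟩ with h1 | h1
      · right
        intro h2
        apply h1
        rw [norm_div] at *
        rw [div_eq_one_iff_eq (norm_ne_zero_iff.2 hκ0)] at h2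
        rw [h2, div_self (norm_ne_zero_iff.2 hκ0)]
      · left
        rw [div_eq_one_iff_eq he0] at h1
        exact ⟨by rw [← h1, div_self hκ0], div_ne_zero hc0 hκ0⟩
    · intro u
      rw [hNe, hNe, hmk]
      · refine Eq.trans ?_ (mk_smul κ hκ0 _ _)
        congr 1
        ext
        · simp only
          field_simp
          rw [hκ]
          linear_combination u * haz
        · simp only
          field_simp
          rw [he]; ring
      · intro h
        have h1 : z₀ * u + 1 = 0 := congrArg Prod.fst h
        have h2 : u = 0 := congrArg Prod.snd h
        rw [h2] at h1; simp at h1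

lemma act_one (h : Fin 1 → CSphere → CSphere) (l : List (Fin 1)) :
    act h l = (h 0)^[l.length] := by
  induction l with
  | nil => rfl
  | cons i l ih =>
    rw [Subsingleton.elim i 0, act, ih]
    rfl

lemma exists_nonrec {m : ℕ} (hm : 0 < m) (h : Fin m → CSphere → CSphere)
    (hrat : ∀ j, CSphere.IsNonconstRatMap (h j))
    (hm1 : m = 1 → ∀ j, h j ≠ id ∧ ¬ IsEllipticMobius (h j))
    (U : Set CSphere) (hosc : OpenSetCond h U)
    (hneq : rsJulia (genFin h) ≠ closure U) :
    ∃ x ∈ U ∩ rsFatou (genFin h), ∃ ε > 0, ∀ l : List (Fin m), l ≠ [] →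
      ε ≤ dist (act h l x) x := by
  have hh : ∀ i, Hol (h i) := fun i => hol_of_rat (hrat i)
  by_cases h1 : m = 1
  · subst h1
    obtain ⟨n, hn1, hdeg⟩ := hrat 0
    by_cases hn : n = 1
    · subst hn
      obtain ⟨x, hx, ε, hε, H⟩ := mobius_nonrec (h 0) hdeg (hm1 rfl 0).1 (hm1 rfl 0).2
        (hosc.2.1.inter (isOpen_fatou _)) (inter_nonempty hh hosc hneq)
      refine ⟨x, hx, ε, hε, fun l hl => ?_⟩
      rw [act_one]
      exact H _ (List.length_pos_of_ne_nil hl)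
    · obtain ⟨p, q, ⟨hq, hc, e⟩, hmx⟩ := hdeg
      obtain ⟨a₁, a₂, hne, he, hU⟩ := exists_pair p q hc n (by omega) hmx hosc.2.1 hosc.1
      rw [← e] at he hU
      exact nonrec_of_pair hm hh hosc hneq 0 0 a₁ a₂ hne he hU
  · obtain ⟨y, hy⟩ := hosc.1
    obtain ⟨a₁, e₁⟩ := (hh ⟨0, hm⟩).surjective y
    obtain ⟨a₂, e₂⟩ := (hh ⟨1, by omega⟩).surjective y
    refine nonrec_of_pair hm hh hosc hneq ⟨0, hm⟩ ⟨1, by omega⟩ a₁ a₂ ?_ (e₁.trans e₂.symm)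
      (e₁ ▸ hy)
    rintro rfl
    have := idx_eq hosc (e₁ ▸ hy) (e₂ ▸ hy)
    simp at this

end SP
end

noncomputable section
open Set Metric Topology Filter MeasureTheory
open scoped ENNReal NNReal ComplexConjugate

namespace SP

open CSphere

lemma le_of_sq_le_sq_aux {x y : ℝ} (h : x ^ 2 ≤ y ^ 2) (hy : 0 ≤ y) : x ≤ y :=
  (le_abs_self x).trans (abs_le_of_sq_le_sq h hy)

def chi (a b : ℂ) : ℝ := 2 * ‖a - b‖ / √((1 + ‖a‖ ^ 2) * (1 + ‖b‖ ^ 2))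

lemma chi_nonneg (a b : ℂ) : 0 ≤ chi a b := by unfold chi; positivity

lemma chi_sq (a b : ℂ) : chi a b ^ 2 =
    ‖(2 / (1 + ‖a‖ ^ 2)) • a - (2 / (1 + ‖b‖ ^ 2)) • b‖ ^ 2 +
      ((‖a‖ ^ 2 - 1) / (‖a‖ ^ 2 + 1) - (‖b‖ ^ 2 - 1) / (‖b‖ ^ 2 + 1)) ^ 2 := by
  have hA : 0 < 1 + ‖a‖ ^ 2 := by positivity
  have hB : 0 < 1 + ‖b‖ ^ 2 := by positivity
  rw [chi, div_pow, Real.sq_sqrt (by positivity), add_comm (‖a‖ ^ 2) 1, add_comm (‖b‖ ^ 2) 1,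
    mul_pow]
  have ea : ‖a‖ ^ 2 = a.re ^ 2 + a.im ^ 2 := by rw [Complex.sq_norm, Complex.normSq_apply]; ring
  have eb : ‖b‖ ^ 2 = b.re ^ 2 + b.im ^ 2 := by rw [Complex.sq_norm, Complex.normSq_apply]; ring
  have e1 : ‖a - b‖ ^ 2 = (a.re - b.re) ^ 2 + (a.im - b.im) ^ 2 := by
    rw [Complex.sq_norm, Complex.normSq_apply]; simp; ring
  have e2 : ‖(2 / (1 + ‖a‖ ^ 2)) • a - (2 / (1 + ‖b‖ ^ 2)) • b‖ ^ 2 =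
      ((2 / (1 + ‖a‖ ^ 2)) * a.re - (2 / (1 + ‖b‖ ^ 2)) * b.re) ^ 2 +
      ((2 / (1 + ‖a‖ ^ 2)) * a.im - (2 / (1 + ‖b‖ ^ 2)) * b.im) ^ 2 := by
    rw [Complex.sq_norm, Complex.normSq_apply]
    simp only [Complex.sub_re, Complex.sub_im, Complex.smul_re, Complex.smul_im, smul_eq_mul]
    ring
  rw [e2, e1]
  rw [ea] at hA ⊢
  rw [eb] at hB ⊢
  field_simp
  ring

lemma dist_ofC (a b : ℂ) : dist (ofC a) (ofC b) =
    max ‖(2 / (1 + ‖a‖ ^ 2)) • a - (2 / (1 + ‖b‖ ^ 2)) • b‖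
      |(‖a‖ ^ 2 - 1) / (‖a‖ ^ 2 + 1) - (‖b‖ ^ 2 - 1) / (‖b‖ ^ 2 + 1)| := by
  have : dist (ofC a) (ofC b) = dist (embed (ofC a)) (embed (ofC b)) := rfl
  rw [this, embed_ofC, embed_ofC, Prod.dist_eq, dist_eq_norm, Real.dist_eq]

lemma dist_le_chi (a b : ℂ) : dist (ofC a) (ofC b) ≤ chi a b := by
  rw [dist_ofC]
  refine max_le ?_ ?_
  · refine le_of_sq_le_sq_aux ?_ (chi_nonneg a b)
    rw [chi_sq]; nlinarith [sq_nonneg ((‖a‖ ^ 2 - 1) / (‖a‖ ^ 2 + 1) - (‖b‖ ^ 2 - 1) / (‖b‖ ^ 2 + 1))]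
  · refine abs_le_of_sq_le_sq ?_ (chi_nonneg a b)
    rw [chi_sq]; nlinarith [sq_nonneg ‖(2 / (1 + ‖a‖ ^ 2)) • a - (2 / (1 + ‖b‖ ^ 2)) • b‖]

lemma chi_le_dist (a b : ℂ) : chi a b ≤ 2 * dist (ofC a) (ofC b) := by
  refine le_of_sq_le_sq_aux ?_ (by positivity)
  rw [chi_sq, dist_ofC]
  set x := ‖(2 / (1 + ‖a‖ ^ 2)) • a - (2 / (1 + ‖b‖ ^ 2)) • b‖
  set y := (‖a‖ ^ 2 - 1) / (‖a‖ ^ 2 + 1) - (‖b‖ ^ 2 - 1) / (‖b‖ ^ 2 + 1)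
  have h1 : x ^ 2 ≤ (max x |y|) ^ 2 := pow_le_pow_left₀ (norm_nonneg _) (le_max_left _ _) 2
  have h2 : |y| ^ 2 ≤ (max x |y|) ^ 2 := pow_le_pow_left₀ (abs_nonneg _) (le_max_right _ _) 2
  rw [sq_abs] at h2
  nlinarith [sq_nonneg (max x |y|)]

lemma lip_ofC : LipschitzWith 2 ofC := by
  refine LipschitzWith.of_dist_le_mul fun a b => ?_
  refine (dist_le_chi a b).trans ?_
  rw [chi, dist_eq_norm]
  refine div_le_of_le_mul₀ (by positivity) (by positivity) ?_
  have : 1 ≤ √((1 + ‖a‖ ^ 2) * (1 + ‖b‖ ^ 2)) := by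
    rw [Real.one_le_sqrt]
    nlinarith [sq_nonneg ‖a‖, sq_nonneg ‖b‖, mul_nonneg (sq_nonneg ‖a‖) (sq_nonneg ‖b‖)]
  push_cast
  nlinarith [norm_nonneg (a - b)]

lemma nhdsNe_ofC (w : ℂ) : 𝓝[≠] (ofC w) = map ofC (𝓝[≠] w) := by
  rw [← isOpenEmbedding_ofC.map_nhdsWithin_preimage_eq]
  congr 2
  ext z
  simp only [mem_preimage, mem_compl_iff, mem_singleton_iff]
  exact ⟨fun h e => h (by rw [e]), fun h e => h (ofC_inj e)⟩

lemma sphDeriv_bound (g : CSphere → CSphere) (f : ℂ → ℂ) (w f' : ℂ) (hf : HasDerivAt f f' w)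
    (he : ∀ᶠ u in 𝓝 w, g (ofC u) = ofC (f u)) :
    (f' = 0 → sphDeriv g (ofC w) = 0) ∧
      ‖f'‖ * (1 + ‖w‖ ^ 2) / (1 + ‖f w‖ ^ 2) / 2 ≤ sphDeriv g (ofC w) := by
  set ρ : ℂ → ℝ := fun u => chi (f u) (f w) / chi u w with hρ
  set r : ℂ → ℝ := fun u => dist (g (ofC u)) (g (ofC w)) / dist (ofC u) (ofC w) with hr
  have hsd : sphDeriv g (ofC w) = limsup r (𝓝[≠] w) := by
    rw [sphDeriv, nhdsNe_ofC]; rfl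
  have hlim : Tendsto ρ (𝓝[≠] w) (𝓝 (‖f'‖ * (1 + ‖w‖ ^ 2) / (1 + ‖f w‖ ^ 2))) := by
    have h1 : Tendsto (fun u => ‖slope f w u‖) (𝓝[≠] w) (𝓝 ‖f'‖) :=
      (hasDerivAt_iff_tendsto_slope.1 hf).norm
    have hfc : ContinuousAt f w := hf.continuousAt
    have h2 : Tendsto (fun u => √((1 + ‖u‖ ^ 2) * (1 + ‖w‖ ^ 2)) /
        √((1 + ‖f u‖ ^ 2) * (1 + ‖f w‖ ^ 2))) (𝓝[≠] w)
        (𝓝 (√((1 + ‖w‖ ^ 2) * (1 + ‖w‖ ^ 2)) / √((1 + ‖f w‖ ^ 2) * (1 + ‖f w‖ ^ 2)))) := by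
      have : ContinuousAt (fun u => √((1 + ‖u‖ ^ 2) * (1 + ‖w‖ ^ 2)) /
        √((1 + ‖f u‖ ^ 2) * (1 + ‖f w‖ ^ 2))) w := by
        refine ContinuousAt.div ?_ ?_ ?_
        · fun_prop
        · fun_prop
        · positivity
      exact this.mono_left nhdsWithin_le_nhds
    have h3 := h1.mul h2
    rw [Real.sqrt_mul_self (by positivity), Real.sqrt_mul_self (by positivity),
      ← mul_div_assoc] at h3
    refine h3.congr' ?_
    filter_upwards [self_mem_nhdsWithin] with u hu
    have hu' : ‖u - w‖ ≠ 0 := norm_ne_zero_iff.2 (sub_ne_zero.2 hu)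
    have p1 : √((1 + ‖u‖ ^ 2) * (1 + ‖w‖ ^ 2)) ≠ 0 := by positivity
    have p2 : √((1 + ‖f u‖ ^ 2) * (1 + ‖f w‖ ^ 2)) ≠ 0 := by positivity
    rw [hρ]
    simp only [chi, slope_def_field, norm_div]
    field_simp
  have hb1 : ∀ᶠ u in 𝓝[≠] w, r u ≤ 2 * ρ u ∧ ρ u / 2 ≤ r u ∧ 0 ≤ r u := by
    filter_upwards [self_mem_nhdsWithin, he.filter_mono nhdsWithin_le_nhds] with u hu heu
    have hgw := he.self_of_nhds
    have hd : 0 < dist (ofC u) (ofC w) := dist_pos.2 fun h => hu (ofC_inj h)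
    have hc : 0 < chi u w := hd.trans_le (dist_le_chi u w)
    rw [hr, hρ]
    simp only
    rw [heu, hgw]
    have a1 := dist_le_chi u w
    have a2 := chi_le_dist u w
    have b1 := dist_le_chi (f u) (f w)
    have b2 := chi_le_dist (f u) (f w)
    have c1 := chi_nonneg (f u) (f w)
    have d1 : 0 ≤ dist (ofC (f u)) (ofC (f w)) := dist_nonneg
    refine ⟨?_, ?_, by positivity⟩
    · rw [← mul_div_assoc, div_le_div_iff₀ hd hc]
      nlinarith
    · rw [div_div, div_le_div_iff₀ (by positivity) hd]
      nlinarith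
  have hne : (𝓝[≠] w).NeBot := inferInstance
  rw [hsd]
  constructor
  · intro h0
    refine Tendsto.limsup_eq ?_
    rw [h0] at hlim
    have h2 := hlim.const_mul 2
    simp only [norm_zero, zero_mul, zero_div, mul_zero] at h2
    refine tendsto_of_tendsto_of_tendsto_of_le_of_le' tendsto_const_nhds h2 ?_ ?_
    · filter_upwards [hb1] with u hu using hu.2.2
    · filter_upwards [hb1] with u hu using hu.1
  · refine le_limsup_of_le ?_ ?_
    · have hev := hlim.eventually (Iio_mem_nhds (lt_add_one _))
      refine isBoundedUnder_of_eventually_le (a := 2 * (‖f'‖ * (1 + ‖w‖ ^ 2) / (1 + ‖f w‖ ^ 2) + 1)) ?_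
      filter_upwards [hb1, hev] with u hu hu2
      have := hu.1
      have : ρ u < ‖f'‖ * (1 + ‖w‖ ^ 2) / (1 + ‖f w‖ ^ 2) + 1 := hu2
      linarith
    · intro b hb
      refine le_of_tendsto (hlim.div_const 2) ?_
      filter_upwards [hb, hb1] with u h1 h2
      exact h2.2.1.trans h1

lemma null_image (N : Set ℂ) (hN : volume N = 0) :
    Measure.hausdorffMeasure (2:ℝ) (ofC '' N) = 0 := by
  have h1 : Measure.hausdorffMeasure (2:ℝ) N = 0 := by
    have hr : (Module.finrank ℝ ℂ : ℝ) = 2 := by simp [Complex.finrank_real_complex]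
    have hH : Measure.IsAddHaarMeasure (Measure.hausdorffMeasure (X := ℂ) (2:ℝ)) := by
      have := MeasureTheory.isAddHaarMeasure_hausdorffMeasure (E := ℂ)
      rwa [hr] at this
    exact (Measure.absolutelyContinuous_isAddHaarMeasure _ volume) hN
  have h2 := lip_ofC.hausdorffMeasure_image_le (d := 2) (by norm_num) N
  rw [h1, mul_zero] at h2
  exact le_antisymm h2 bot_le

end SP
end

noncomputable section
open Set Metric Topology Filter MeasureTheory
open scoped ENNReal NNReal ComplexConjugate

namespace SP

open CSphere

lemma det_mul (a : ℂ) : |((ContinuousLinearMap.toSpanSingleton ℂ a).restrictScalars ℝ : ℂ →L[ℝ] ℂ).det|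
    = ‖a‖ ^ 2 := by
  have : ((ContinuousLinearMap.toSpanSingleton ℂ a).restrictScalars ℝ : ℂ →L[ℝ] ℂ).det = ‖a‖ ^ 2 := by
    simp [ContinuousLinearMap.det, LinearMap.det_restrictScalars,
      Algebra.norm_complex_eq, Complex.normSq_eq_norm_sq]
  rw [this, abs_of_nonneg (by positivity)]

def dens (w : ℂ) : ℝ≥0∞ := ENNReal.ofReal (((1 + ‖w‖ ^ 2) ^ 2)⁻¹)

lemma measurable_dens : Measurable dens := by unfold dens; fun_prop

lemma lintegral_dens : ∫⁻ w, dens w < ⊤ := by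
  have h := (integrable_rpow_neg_one_add_norm_sq (E := ℂ) (μ := volume) (r := 4)
    (by rw [Complex.finrank_real_complex]; norm_num)).lintegral_lt_top
  refine lt_of_eq_of_lt ?_ h
  congr 1
  ext1 w
  rw [dens]
  congr 1
  rw [show (-4 / 2 : ℝ) = -(2:ℕ) by norm_num, Real.rpow_neg (by positivity), Real.rpow_natCast]

def psi (f : ℂ → ℂ) (w : ℂ) : ℝ≥0∞ := (ENNReal.ofReal (‖deriv f w‖ ^ 2))⁻¹ * dens w

lemma measurable_psi (f : ℂ → ℂ) : Measurable (psi f) := by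
  unfold psi
  have := measurable_deriv f
  exact (this.norm.pow_const 2).ennreal_ofReal.inv.mul measurable_dens

/-- local decomposition of a holomorphic map into injective pieces -/
lemma pieces {g : CSphere → CSphere} (hg : Hol g) : ∃ (f : ℂ → ℂ) (A : ℕ → Set ℂ),
    (∀ n, MeasurableSet (A n)) ∧ Pairwise (fun i j => Disjoint (A i) (A j)) ∧
    (∀ n, InjOn f (A n)) ∧
    (∀ n, ∀ w ∈ A n, DifferentiableAt ℂ f w ∧ deriv f w ≠ 0 ∧ g (ofC w) = ofC (f w)) ∧
    ∀ w, g (ofC w) ≠ infty → g (ofC w) = ofC (f w) ∧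
      ENNReal.ofReal (sphDeriv g (ofC w) ^ (-2 : ℝ)) ≤
      ENNReal.ofReal (4 * (1 + ‖f w‖ ^ 2) ^ 2) * ∑' n, (A n).indicator (psi f) w := by
  obtain ⟨⟨L, hL1, hL2, hL3⟩, -⟩ := hg
  set P : ℂ → ℂ := fun w => (L (w, 1)).1 with hP
  set Q : ℂ → ℂ := fun w => (L (w, 1)).2 with hQ
  have hPd : Differentiable ℂ P := by
    have : Differentiable ℂ (fun w : ℂ => L (w, 1)) := hL1.comp (by fun_prop)
    exact this.fst
  have hQd : Differentiable ℂ Q := by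
    have : Differentiable ℂ (fun w : ℂ => L (w, 1)) := hL1.comp (by fun_prop)
    exact this.snd
  have hgm : ∀ w, g (ofC w) = mk (P w, Q w) := by
    intro w
    rw [← mk_one, ← hL3 _ (ne_zero_left w)]
  set f : ℂ → ℂ := fun w => P w / Q w with hf
  have hgf : ∀ w, Q w ≠ 0 → g (ofC w) = ofC (f w) := fun w hw => by rw [hgm, mk_ne hw]
  have hfa : ∀ w, Q w ≠ 0 → AnalyticAt ℂ f w := fun w hw =>
    (hPd.analyticAt w).div (hQd.analyticAt w) hw
  have hDo : IsOpen {w | Q w ≠ 0} := isOpen_ne_fun hQd.continuous continuous_const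
  set D : Set ℂ := {w | Q w ≠ 0 ∧ deriv f w ≠ 0} with hD
  have hDopen : IsOpen D := by
    rw [isOpen_iff_mem_nhds]
    rintro w ⟨h1, h2⟩
    have := (hfa w h1).deriv.continuousAt.eventually_ne h2
    exact Filter.Eventually.and (hDo.mem_nhds h1) this
  have hloc : ∀ w ∈ D, ∃ s ∈ 𝓝[D] w, IsOpen s ∧ InjOn f s := by
    rintro w ⟨h1, h2⟩
    have hs : HasStrictDerivAt f (deriv f w) w := (hfa w h1).hasStrictDerivAt
    have hs' := hs.hasStrictFDerivAt_equiv h2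
    refine ⟨(hs'.toOpenPartialHomeomorph f).source, ?_, ?_, ?_⟩
    · exact mem_nhdsWithin_of_mem_nhds ((hs'.toOpenPartialHomeomorph f).open_source.mem_nhds
        hs'.mem_toOpenPartialHomeomorph_source)
    · exact (hs'.toOpenPartialHomeomorph f).open_source
    · have := (hs'.toOpenPartialHomeomorph f).injOn
      simpa using this
  choose! s hs1 hs2 hs3 using hloc
  obtain ⟨B, hBo, hBi, hBc⟩ : ∃ B : ℕ → Set ℂ, (∀ n, MeasurableSet (B n)) ∧ (∀ n, InjOn f (B n)) ∧
      D ⊆ ⋃ n, B n := by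
    obtain ⟨t, htD, htc, hcov⟩ := TopologicalSpace.countable_cover_nhdsWithin hs1
    rcases t.eq_empty_or_nonempty with rfl | hne
    · refine ⟨fun _ => ∅, fun _ => MeasurableSet.empty, fun _ => injOn_empty _, ?_⟩
      simpa using hcov
    · obtain ⟨e, rfl⟩ := htc.exists_eq_range hne
      refine ⟨fun n => s (e n), fun n => (hs2 _ (htD ⟨n, rfl⟩)).measurableSet,
        fun n => hs3 _ (htD ⟨n, rfl⟩), ?_⟩
      simpa using hcov
  set B' : ℕ → Set ℂ := fun n => B n ∩ D with hB'
  have hsub : ∀ n, disjointed B' n ⊆ B' n := fun n => disjointed_subset B' n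
  have hun : ⋃ n, disjointed B' n = D := by
    rw [iUnion_disjointed]
    apply subset_antisymm
    · exact iUnion_subset fun n => inter_subset_right
    · intro w hw
      obtain ⟨n, hn⟩ := mem_iUnion.1 (hBc hw)
      exact mem_iUnion.2 ⟨n, hn, hw⟩
  refine ⟨f, disjointed B', ?_, ?_, ?_, ?_, ?_⟩
  · exact fun n => MeasurableSet.disjointed (fun n => (hBo n).inter hDopen.measurableSet) n
  · exact disjoint_disjointed B'
  · exact fun n => (hBi n).mono fun w hw => (hsub n hw).1
  · intro n w hw
    have hwD := (hsub n hw).2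
    exact ⟨(hfa w hwD.1).differentiableAt, hwD.2, hgf w hwD.1⟩
  · intro w hw
    have hQw : Q w ≠ 0 := by
      intro h0
      apply hw
      rw [hgm, h0, mk_zero]
    refine ⟨hgf w hQw, ?_⟩
    have hev : ∀ᶠ u in 𝓝 w, g (ofC u) = ofC (f u) := by
      filter_upwards [hDo.mem_nhds hQw] with u hu using hgf u hu
    obtain ⟨hb1, hb2⟩ := sphDeriv_bound g f w (deriv f w)
      (hfa w hQw).differentiableAt.hasDerivAt hev
    by_cases h0 : deriv f w = 0
    · rw [hb1 h0, Real.zero_rpow (by norm_num)]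
      simp
    · have hwD : w ∈ D := ⟨hQw, h0⟩
      rw [← hun] at hwD
      obtain ⟨n, hn⟩ := mem_iUnion.1 hwD
      have h1 : psi f w ≤ ∑' n, (disjointed B' n).indicator (psi f) w := by
        refine le_trans ?_ (ENNReal.le_tsum n)
        rw [indicator_of_mem hn]
      refine le_trans ?_ (mul_le_mul_right h1 _)
      have hp : 0 < ‖deriv f w‖ := norm_pos_iff.2 h0
      have hp1 : 0 < 1 + ‖w‖ ^ 2 := by positivity
      have hp2 : 0 < 1 + ‖f w‖ ^ 2 := by positivity
      have ht : 0 < ‖deriv f w‖ * (1 + ‖w‖ ^ 2) / (1 + ‖f w‖ ^ 2) / 2 := by positivity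
      rw [psi, dens, ← ENNReal.ofReal_inv_of_pos (by positivity),
        ← ENNReal.ofReal_mul (by positivity), ← ENNReal.ofReal_mul (by positivity)]
      apply ENNReal.ofReal_le_ofReal
      rw [Real.rpow_neg (ht.le.trans hb2), Real.rpow_two]
      have h2 := pow_le_pow_left₀ ht.le hb2 2
      refine (inv_anti₀ (by positivity) h2).trans (le_of_eq ?_)
      field_simp
      norm_num

/-- change of variables for an injective piece -/
lemma piece_int (f : ℂ → ℂ) (A : Set ℂ) (hA : MeasurableSet A) (hi : InjOn f A)
    (hd : ∀ w ∈ A, DifferentiableAt ℂ f w ∧ deriv f w ≠ 0) (B : Set ℂ) (hB : MeasurableSet B) :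
    ∃ E : ℂ → ℝ≥0∞, Measurable E ∧ (∀ w ∈ A, E (f w) = psi f w) ∧
      ∫⁻ b in B, E b = ∫⁻ w in A ∩ f ⁻¹' B, dens w := by
  have hc : ContinuousOn f A := fun w hw => (hd w hw).1.continuousAt.continuousWithinAt
  have hemb : MeasurableEmbedding (A.restrict f) := hc.measurableEmbedding hA hi
  set E := Function.extend (A.restrict f) (fun w : A => psi f w) (fun _ => 0) with hE
  have hEm : Measurable E :=
    hemb.measurable_extend ((measurable_psi f).comp measurable_subtype_coe) measurable_const
  have hEv : ∀ w ∈ A, E (f w) = psi f w := by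
    intro w hw
    exact hemb.injective.extend_apply (fun w : A => psi f w) (fun _ => 0) ⟨w, hw⟩
  refine ⟨E, hEm, hEv, ?_⟩
  have hs : MeasurableSet (A ∩ f ⁻¹' B) := by
    have h1 : A ∩ f ⁻¹' B = Subtype.val '' ((A.restrict f) ⁻¹' B) := by
      ext w
      constructor
      · rintro ⟨h1, h2⟩; exact ⟨⟨w, h1⟩, h2, rfl⟩
      · rintro ⟨⟨w, h1⟩, h2, rfl⟩; exact ⟨h1, h2⟩
    rw [h1]
    exact hA.subtype_image (hemb.measurable hB)
  have himm : MeasurableSet (f '' A) := by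
    rw [← range_domRestrict]; exact hemb.measurableSet_range
  have h1 : ∫⁻ b in B, E b = ∫⁻ b in f '' (A ∩ f ⁻¹' B), E b := by
    rw [image_inter_preimage, ← Measure.restrict_restrict himm, ← lintegral_indicator himm]
    congr 1
    ext1 b
    by_cases hb : b ∈ f '' A
    · rw [indicator_of_mem hb]
    · rw [indicator_of_notMem hb, hE, Function.extend_apply']
      rintro ⟨⟨w, hw⟩, e⟩
      exact hb ⟨w, hw, e⟩
  rw [h1, lintegral_image_eq_lintegral_abs_det_fderiv_mul volume hs
    (f' := fun w => (ContinuousLinearMap.toSpanSingleton ℂ (deriv f w)).restrictScalars ℝ)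
    (fun w hw => ?_) (hi.mono inter_subset_left)]
  · refine setLIntegral_congr_fun hs fun w hw => ?_
    rw [det_mul, hEv w hw.1, psi, ← mul_assoc, ENNReal.mul_inv_cancel, one_mul]
    · have := (hd w hw.1).2
      have : 0 < ‖deriv f w‖ := norm_pos_iff.2 this
      simp only [ne_eq, ENNReal.ofReal_eq_zero, not_le]
      positivity
    · exact ENNReal.ofReal_ne_top
  · exact ((hd w hw.1).1.hasDerivAt.hasFDerivAt.restrictScalars ℝ).hasFDerivWithinAt

lemma fibre_bound {g : CSphere → CSphere} (f : ℂ → ℂ) (A : ℕ → Set ℂ)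
    (hi : ∀ n, InjOn f (A n))
    (hb : ∀ w, g (ofC w) ≠ infty → g (ofC w) = ofC (f w) ∧
      ENNReal.ofReal (sphDeriv g (ofC w) ^ (-2 : ℝ)) ≤
      ENNReal.ofReal (4 * (1 + ‖f w‖ ^ 2) ^ 2) * ∑' n, (A n).indicator (psi f) w)
    (E : ℕ → ℂ → ℝ≥0∞) (hE : ∀ n, ∀ w ∈ A n, E n (f w) = psi f w) (b : ℂ)
    (hinf : g infty ≠ ofC b) :
    ∑' y : (g ⁻¹' {ofC b}), ENNReal.ofReal (sphDeriv g (y : CSphere) ^ (-2 : ℝ)) ≤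
      ENNReal.ofReal (4 * (1 + ‖b‖ ^ 2) ^ 2) * ∑' n, E n b := by
  have hy : ∀ y : (g ⁻¹' {ofC b}), ∃ w, (y : CSphere) = ofC w ∧ f w = b ∧
      ENNReal.ofReal (sphDeriv g (y : CSphere) ^ (-2 : ℝ)) ≤
      ENNReal.ofReal (4 * (1 + ‖b‖ ^ 2) ^ 2) * ∑' n, (A n).indicator (psi f) w := by
    rintro ⟨y, hy⟩
    have hy' : g y = ofC b := hy
    rcases cases' y with rfl | ⟨w, rfl⟩
    · exact (hinf hy').elim
    · obtain ⟨h1, h2⟩ := hb w (by rw [hy']; exact ofC_ne_infty b)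
      have h3 : f w = b := ofC_inj (h1.symm.trans hy')
      rw [h3] at h2
      exact ⟨w, rfl, h3, h2⟩
  choose W hW1 hW2 hW3 using hy
  have hWi : ∀ y y', W y = W y' → y = y' := by
    intro y y' h
    apply Subtype.ext
    rw [hW1, hW1, h]
  calc _ ≤ ∑' y : (g ⁻¹' {ofC b}), ENNReal.ofReal (4 * (1 + ‖b‖ ^ 2) ^ 2) *
          ∑' n, (A n).indicator (psi f) (W y) := ENNReal.tsum_le_tsum hW3
    _ = ENNReal.ofReal (4 * (1 + ‖b‖ ^ 2) ^ 2) *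
          ∑' n, ∑' y : (g ⁻¹' {ofC b}), (A n).indicator (psi f) (W y) := by
        rw [ENNReal.tsum_mul_left, ENNReal.tsum_comm]
    _ ≤ _ := by
        refine mul_le_mul_right (ENNReal.tsum_le_tsum fun n => ?_) _
        by_cases hex : ∃ y₀, W y₀ ∈ A n
        · obtain ⟨y₀, hy₀⟩ := hex
          rw [tsum_eq_single y₀, indicator_of_mem hy₀, ← hE n _ hy₀, hW2]
          intro y hne
          rw [indicator_of_notMem]
          intro hmem
          exact hne (hWi _ _ (hi n hmem hy₀ (by rw [hW2, hW2])))
        · push Not at hex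
          have : ∀ y, (A n).indicator (psi f) (W y) = 0 := fun y => indicator_of_notMem (hex y) _
          simp [this]

end SP
end

noncomputable section
open Set Metric Topology Filter MeasureTheory
open scoped ENNReal NNReal ComplexConjugate

namespace SP

open CSphere

lemma ae_finite (G : Set (CSphere → CSphere)) (hG : G.Countable) (hH : ∀ g ∈ G, Hol g)
    (B : Set ℂ) (hB : MeasurableSet B)
    (hdis : ∀ g ∈ G, ∀ g' ∈ G, g ≠ g' → Disjoint (g ⁻¹' (ofC '' B)) (g' ⁻¹' (ofC '' B))) :
    ∀ᵐ b ∂(volume.restrict B), Ssum G 2 (ofC b) < ⊤ := by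
  have hGc : Countable G := hG.to_subtype
  choose f A hA1 hA2 hA3 hA4 hA5 using fun g : G => pieces (hH g g.2)
  choose E hE1 hE2 hE3 using fun (g : G) (n : ℕ) => piece_int (f g) (A g n) (hA1 g n) (hA3 g n)
    (fun w hw => ⟨(hA4 g n w hw).1, (hA4 g n w hw).2.1⟩) B hB
  have hsm : ∀ i : G × ℕ, MeasurableSet (A i.1 i.2 ∩ f i.1 ⁻¹' B) := by
    rintro ⟨g, n⟩
    have hc : ContinuousOn (f g) (A g n) := fun w hw =>
      (hA4 g n w hw).1.continuousAt.continuousWithinAt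
    have hm : Measurable ((A g n).restrict (f g)) := hc.restrict.measurable
    have h1 : A g n ∩ f g ⁻¹' B = Subtype.val '' (((A g n).restrict (f g)) ⁻¹' B) := by
      ext w
      constructor
      · rintro ⟨h1, h2⟩; exact ⟨⟨w, h1⟩, h2, rfl⟩
      · rintro ⟨⟨w, h1⟩, h2, rfl⟩; exact ⟨h1, h2⟩
    show MeasurableSet (A g n ∩ f g ⁻¹' B)
    rw [h1]
    exact (hA1 g n).subtype_image (hm hB)
  have hsd : Pairwise (fun i j : G × ℕ =>
      Disjoint (A i.1 i.2 ∩ f i.1 ⁻¹' B) (A j.1 j.2 ∩ f j.1 ⁻¹' B)) := by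
    rintro ⟨g, n⟩ ⟨g', n'⟩ hne
    by_cases hgg : g = g'
    · subst hgg
      have : n ≠ n' := fun h => hne (by rw [h])
      exact (hA2 g this).mono inter_subset_left inter_subset_left
    · rw [Set.disjoint_left]
      rintro w ⟨h1, h2⟩ ⟨h3, h4⟩
      have hdd := Set.disjoint_left.1 (hdis g g.2 g' g'.2 fun h => hgg (Subtype.ext h))
      exact @hdd (ofC w) ⟨f g w, h2, ((hA4 g n w h1).2.2).symm⟩
        ⟨f g' w, h4, ((hA4 g' n' w h3).2.2).symm⟩
  have hfin : ∫⁻ b in B, ∑' i : G × ℕ, E i.1 i.2 b < ⊤ := by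
    rw [lintegral_tsum (f := fun (i : G × ℕ) b => E i.1 i.2 b)
      (fun i => (hE1 i.1 i.2).aemeasurable)]
    simp_rw [hE3]
    rw [← lintegral_iUnion hsm hsd]
    exact (setLIntegral_le_lintegral _ _).trans_lt lintegral_dens
  have hae := ae_lt_top (Measurable.ennreal_tsum fun i : G × ℕ => hE1 i.1 i.2) hfin.ne
  have hbad : (ofC ⁻¹' (range fun g : G => (g : CSphere → CSphere) infty)).Countable :=
    (countable_range _).preimage (fun a b h => ofC_inj h)
  have hae2 : ∀ᵐ b ∂(volume.restrict B),
      b ∉ ofC ⁻¹' (range fun g : G => (g : CSphere → CSphere) infty) :=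
    ae_restrict_of_ae (hbad.ae_notMem volume)
  filter_upwards [hae, hae2] with b hb1 hb2
  rw [Ssum]
  refine lt_of_le_of_lt (b := ENNReal.ofReal (4 * (1 + ‖b‖ ^ 2) ^ 2) *
    ∑' i : G × ℕ, E i.1 i.2 b) ?_ (ENNReal.mul_lt_top ENNReal.ofReal_lt_top hb1)
  rw [ENNReal.tsum_prod' (f := fun i : G × ℕ => E i.1 i.2 b), ← ENNReal.tsum_mul_left]
  refine ENNReal.tsum_le_tsum fun g => ?_
  exact fibre_bound (f g) (A g) (hA3 g) (hA5 g) (E g) (hE2 g) b fun h => hb2 ⟨g, h⟩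

end SP
end

/-- **Proposition (Sumi, Prop 1.33)**.
Let `G = ⟨h₁, …, h_m⟩` be a rational semigroup (with, when `m = 1`, `h₁`
neither the identity nor an elliptic Möbius transformation), satisfying the
open set condition with an open set `U`, and with `J(G) ≠ Ū`.  Then there is a
(nonempty) open set `V ⊆ U ∩ F(G)` such that `S(2, x) < ∞` for Lebesgue-almost
every `x ∈ V`; in particular `s₀(G) ≤ 2`. -/
theorem finite_poincare_series_on_open_set
    {m : ℕ} (hm : 0 < m) (h : Fin m → CSphere → CSphere)
    (hrat : ∀ j, CSphere.IsNonconstRatMap (h j))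
    (hm1 : m = 1 → ∀ j, h j ≠ id ∧ ¬ IsEllipticMobius (h j))
    (U : Set CSphere) (hosc : OpenSetCond h U)
    (hneq : rsJulia (genFin h) ≠ closure U) :
    (∃ V : Set CSphere, V.Nonempty ∧ IsOpen V ∧ V ⊆ U ∩ rsFatou (genFin h) ∧
      MeasureTheory.Measure.hausdorffMeasure (2 : ℝ)
        {x ∈ V | ¬ Ssum (genFin h) 2 x < ⊤} = 0) ∧
    s0Exp (genFin h) ≤ 2 := by

  have hh : ∀ i, SP.Hol (h i) := fun i => SP.hol_of_rat (hrat i)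
  obtain ⟨x, hx, ε, hε, hrec⟩ := SP.exists_nonrec hm h hrat hm1 U hosc hneq
  obtain ⟨c, R, hR, hsub, hw⟩ := SP.wander hosc x hx ε hε hrec
  have hae := SP.ae_finite (genFin h) (SP.countable_gen h) (SP.gen_hol hh) (ball c R)
    measurableSet_ball (fun g hg g' hg' hne =>
      SP.disj_pre hosc _ (fun v hv => (hsub hv).1) hw g g' hg hg' hne)
  rw [ae_restrict_iff' measurableSet_ball] at hae
  have hnull : volume {b | ¬ (b ∈ ball c R → Ssum (genFin h) 2 (CSphere.ofC b) < ⊤)} = 0 := hae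
  constructor
  · refine ⟨CSphere.ofC '' ball c R, ⟨_, c, mem_ball_self hR, rfl⟩,
      SP.isOpenEmbedding_ofC.isOpenMap _ isOpen_ball, hsub, ?_⟩
    refine measure_mono_null ?_ (SP.null_image _ hnull)
    rintro _ ⟨⟨b, hb, rfl⟩, hS⟩
    exact ⟨b, fun hc => hS (hc hb), rfl⟩
  · have hmem : ∃ b ∈ ball c R, Ssum (genFin h) 2 (CSphere.ofC b) < ⊤ := by
      by_contra hcon
      push Not at hcon
      have hs : ball c R ⊆ {b | ¬ (b ∈ ball c R → Ssum (genFin h) 2 (CSphere.ofC b) < ⊤)} := by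
        intro b hb hc
        exact absurd (hc hb) (not_lt.2 (hcon b hb))
      have h0 := measure_mono_null hs hnull
      exact (measure_ball_pos volume c hR).ne' h0
    obtain ⟨b, -, hb⟩ := hmem
    have h2 : (2:ℝ) ∈ {s : ℝ | ∃ x : CSphere, Ssum (genFin h) s x < ⊤} := ⟨_, hb⟩
    rw [s0Exp]
    by_cases hbd : BddBelow {s : ℝ | ∃ x : CSphere, Ssum (genFin h) s x < ⊤}
    · exact csInf_le hbd h2
    · rw [Real.sInf_of_not_bddBelow hbd]; norm_num
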